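/- Let K be a number field and suppose ζ_K has a non-real nontrivial zero ρ = Θ'' + iγ (γ ≠ 0) of multiplicity m ≥ 1 whose real part equals Θ'', the supremum of real parts of non-real nontrivial zeros. Then liminf_{x→∞} (M_K(x) − M̃_K(x))/(x^{Θ''}(log x)^{m−1}) ≤ −m/|ρ ζ_K^{(m)}(ρ)| and limsup_{x→∞} (M_K(x) − M̃_K(x))/(x^{Θ''}(log x)^{m−1}) ≥ m/|ρ ζ_K^{(m)}(ρ)|. -/

import Mathlib

noncomputable section

open NumberField Filter Topology MeasureTheory Complex

open scoped Classical

/-- The Möbius function on integral ideals of a number field `K`. -/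
def moebiusK (K : Type) [Field K] [NumberField K] (I : Ideal (𝓞 K)) : ℤ :=
  if Squarefree I then (-1) ^ (UniqueFactorizationMonoid.factors I).card else 0

/-- The Mertens function of a number field `K`: the sum of `μ_K(𝔞)` over nonzero integral
ideals `𝔞` of norm at most `x`, where ideals of norm exactly `x` count with weight `1/2`. -/
def mertensK (K : Type) [Field K] [NumberField K] (x : ℝ) : ℝ :=
  ∑' I : Ideal (𝓞 K),
    if I ≠ ⊥ ∧ (Ideal.absNorm I : ℝ) < x then (moebiusK K I : ℝ)
    else if I ≠ ⊥ ∧ (Ideal.absNorm I : ℝ) = x then (moebiusK K I : ℝ) / 2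
    else 0

/-- `M_K^- = liminf_{x → ∞} M_K(x) / x^{1/2}`, as an extended real number. -/
def MKminus (K : Type) [Field K] [NumberField K] : EReal :=
  Filter.liminf (fun x : ℝ => ((mertensK K x / Real.sqrt x : ℝ) : EReal)) Filter.atTop

/-- `M_K^+ = limsup_{x → ∞} M_K(x) / x^{1/2}`, as an extended real number. -/
def MKplus (K : Type) [Field K] [NumberField K] : EReal :=
  Filter.limsup (fun x : ℝ => ((mertensK K x / Real.sqrt x : ℝ) : EReal)) Filter.atTop

/-- The naïve Mertens-type conjecture over `K`: `-1 ≤ M_K^- ≤ M_K^+ ≤ 1`. -/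
def NaiveMertensConj (K : Type) [Field K] [NumberField K] : Prop :=
  -1 ≤ MKminus K ∧ MKminus K ≤ MKplus K ∧ MKplus K ≤ 1

/-- A predicate identifying the Dedekind zeta function of `K`: a function analytic away
from `s = 1` agreeing with the Dirichlet series `∑ N(𝔞)^{-s}` on `Re s > 1`. -/
def IsDedekindZeta (K : Type) [Field K] [NumberField K] (Z : ℂ → ℂ) : Prop :=
  (∀ s : ℂ, s ≠ 1 → DifferentiableAt ℂ Z s) ∧
  ∀ s : ℂ, 1 < s.re →
    Z s = ∑' I : {I : Ideal (𝓞 K) // I ≠ ⊥}, (Ideal.absNorm I.1 : ℂ) ^ (-s)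

/-- The Riemann hypothesis for a zeta function `Z`: all nontrivial zeros lie on `Re s = 1/2`. -/
def ZetaRH (Z : ℂ → ℂ) : Prop :=
  ∀ ρ : ℂ, Z ρ = 0 → 0 < ρ.re → ρ.re < 1 → ρ.re = 1 / 2

namespace NumberField.Mertens

section Landau
open ProbabilityTheory

variable {Ω : Type*} {mΩ : MeasurableSpace Ω} {μ : Measure Ω} {X : Ω → ℝ}

/-- Landau's theorem for moment generating functions of nonnegative variables. -/
theorem Iio_subset_integrableExpSet_of_analyticOnNhd (hX : AEMeasurable X μ)
    (hpos : ∀ᵐ ω ∂μ, 0 ≤ X ω) {a b : ℝ} (ha : Set.Iio a ⊆ integrableExpSet X μ)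
    {F : ℝ → ℝ} (hF : AnalyticOnNhd ℝ F (Set.Iio b))
    (hFm : ∀ t < a, F t = mgf X μ t) : Set.Iio b ⊆ integrableExpSet X μ := by
  have hmono : ∀ t ∈ integrableExpSet X μ, ∀ t' ≤ t, t' ∈ integrableExpSet X μ := by
    intro t ht t' htt
    refine Integrable.mono' (g := fun ω => Real.exp (t * X ω)) ht ?_ ?_
    · exact (Real.measurable_exp.comp_aemeasurable (hX.const_mul t')).aestronglyMeasurable
    · filter_upwards [hpos] with ω hω
      rw [Real.norm_eq_abs, abs_of_pos (Real.exp_pos _)]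
      gcongr
  by_contra hcon
  obtain ⟨t0, ht0, ht0'⟩ := Set.not_subset.1 hcon
  have hub : ∀ t ∈ integrableExpSet X μ, t < t0 := by
    intro t ht
    by_contra! h
    exact ht0' (hmono t ht t0 h)
  have hbdd : BddAbove (integrableExpSet X μ) := ⟨t0, fun t ht => (hub t ht).le⟩
  set c := sSup (integrableExpSet X μ) with hcdef
  have hne : (integrableExpSet X μ).Nonempty := ⟨a - 1, ha (by simp)⟩
  have hct0 : c ≤ t0 := csSup_le hne fun t ht => (hub t ht).le
  have hcb : c < b := hct0.trans_lt ht0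
  have hIio : Set.Iio c ⊆ integrableExpSet X μ := by
    intro t ht
    obtain ⟨u, hu, htu⟩ := exists_lt_of_lt_csSup hne ht
    exact hmono u hu t htu.le
  have hInterior : Set.Iio c ⊆ interior (integrableExpSet X μ) := interior_maximal hIio isOpen_Iio
  have hEq : Set.EqOn F (mgf X μ) (Set.Iio c) := by
    refine AnalyticOnNhd.eqOn_of_preconnected_of_eventuallyEq (z₀ := min a c - 1)
      (hF.mono fun t ht => lt_trans ht hcb) (analyticOnNhd_mgf.mono hInterior) isPreconnected_Iio
      ?_ ?_
    · simp only [Set.mem_Iio]; linarith [min_le_right a c]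
    · have : min a c - 1 < a := by linarith [min_le_left a c]
      filter_upwards [Iio_mem_nhds this] with t ht using hFm t ht
  obtain ⟨p, hp⟩ := hF c hcb
  obtain ⟨r0, hp⟩ := hp
  obtain ⟨r, hr0, hr⟩ : ∃ r : NNReal, 0 < r ∧ (r : ENNReal) ≤ r0 := by
    obtain ⟨r, h1, h2⟩ := ENNReal.lt_iff_exists_nnreal_btwn.1 hp.r_pos
    exact ⟨r, by exact_mod_cast h1, h2.le⟩
  have hp := hp.mono (by exact_mod_cast hr0) hr
  have hrR : (0 : ℝ) < r := by exact_mod_cast hr0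
  have hn : ‖-((r : ℝ) / 4)‖₊ = r / 4 := by
    ext; simp
  have hq := hp.changeOrigin (y := -((r : ℝ) / 4)) (by
    change ((‖-((r : ℝ) / 4)‖₊ : NNReal) : ENNReal) < _
    rw [hn, ENNReal.coe_lt_coe, ← NNReal.coe_lt_coe]; push_cast; linarith)
  set t1 := c + -((r : ℝ) / 4) with ht1
  have ht1c : t1 < c := by linarith
  have hev : F =ᶠ[𝓝 t1] mgf X μ := by
    filter_upwards [Iio_mem_nhds ht1c] with t ht using hEq ht
  have hqeq := HasFPowerSeriesAt.eq_formalMultilinearSeries hq.hasFPowerSeriesAt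
    ((hasFPowerSeriesAt_mgf (hInterior ht1c)).congr hev.symm)
  have hsum := hq.hasSum (y := (r : ℝ) / 2) (by
    rw [Metric.mem_eball, edist_eq_enorm_sub, sub_zero]
    change ((‖((r : ℝ) / 2)‖₊ : NNReal) : ENNReal) < (r : ENNReal) -
        ((‖-((r : ℝ) / 4)‖₊ : NNReal) : ENNReal)
    rw [hn, ← ENNReal.coe_sub, ENNReal.coe_lt_coe, ← NNReal.coe_lt_coe, NNReal.coe_sub]
    · simp only [coe_nnnorm, Real.norm_eq_abs, NNReal.coe_div]
      rw [abs_of_pos (by positivity)]; push_cast; linarith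
    · rw [← NNReal.coe_le_coe]; push_cast; linarith)
  rw [hqeq] at hsum
  simp only [FormalMultilinearSeries.ofScalars_apply_eq, smul_eq_mul] at hsum
  have hs := hsum.summable
  have key : t1 + (r : ℝ) / 2 ∈ integrableExpSet X μ := by
    change Integrable _ μ
    refine ⟨(Real.measurable_exp.comp_aemeasurable (hX.const_mul _)).aestronglyMeasurable, ?_⟩
    have hXn : ∀ n : ℕ, Integrable (fun ω => X ω ^ n * Real.exp (t1 * X ω)) μ := fun n =>
      integrable_pow_mul_exp_of_mem_interior_integrableExpSet (hInterior ht1c) n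
    have e1 : ∀ᵐ ω ∂μ, ‖Real.exp ((t1 + (r : ℝ) / 2) * X ω)‖ₑ =
        ∑' n : ℕ, ENNReal.ofReal (X ω ^ n * Real.exp (t1 * X ω) * (((r : ℝ) / 2) ^ n / n.factorial)) := by
      filter_upwards [hpos] with ω hω
      rw [Real.enorm_of_nonneg (Real.exp_pos _).le]
      have hs1 : HasSum (fun n : ℕ => X ω ^ n * Real.exp (t1 * X ω) *
          (((r : ℝ) / 2) ^ n / n.factorial))
          (Real.exp ((t1 + (r : ℝ) / 2) * X ω)) := by
        have h := (NormedSpace.expSeries_div_hasSum_exp ((r : ℝ) / 2 * X ω)).mul_left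
            (Real.exp (t1 * X ω))
        rw [← Real.exp_eq_exp_ℝ, ← Real.exp_add] at h
        convert! h using 1
        · ext n; rw [mul_pow]; ring
        · ring_nf
      rw [← hs1.tsum_eq, ENNReal.ofReal_tsum_of_nonneg (fun n => by positivity) hs1.summable]
    unfold HasFiniteIntegral
    rw [lintegral_congr_ae e1, lintegral_tsum]
    · have e2 : ∀ n : ℕ, ∫⁻ ω, ENNReal.ofReal
          (X ω ^ n * Real.exp (t1 * X ω) * (((r : ℝ) / 2) ^ n / n.factorial)) ∂μ
          = ENNReal.ofReal ((∫ ω, X ω ^ n * Real.exp (t1 * X ω) ∂μ) / n.factorial * ((r : ℝ) / 2) ^ n) := by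
        intro n
        rw [← ofReal_integral_eq_lintegral_ofReal ((hXn n).mul_const _), integral_mul_const]
        · congr 1; ring
        · filter_upwards [hpos] with ω hω
          positivity
      rw [tsum_congr e2]
      rw [← ENNReal.ofReal_tsum_of_nonneg]
      · exact ENNReal.ofReal_lt_top
      · intro n
        have : 0 ≤ ∫ ω, X ω ^ n * Real.exp (t1 * X ω) ∂μ := by
          apply integral_nonneg_of_ae
          filter_upwards [hpos] with ω hω
          positivity
        positivity
      · exact hs
    · intro n
      exact ((hXn n).mul_const _).aestronglyMeasurable.aemeasurable.ennreal_ofReal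
  have := le_csSup hbdd key
  rw [← hcdef] at this
  linarith

/-- If the moment generating function of a nonnegative variable extends analytically to `(-∞, b)`,
then it converges there and equals the extension. -/
theorem eq_mgf_of_analyticOnNhd (hX : AEMeasurable X μ)
    (hpos : ∀ᵐ ω ∂μ, 0 ≤ X ω) {a b : ℝ} (ha : Set.Iio a ⊆ integrableExpSet X μ)
    {F : ℝ → ℝ} (hF : AnalyticOnNhd ℝ F (Set.Iio b))
    (hFm : ∀ t < a, F t = mgf X μ t) : ∀ t < b, F t = mgf X μ t := by
  have h := Iio_subset_integrableExpSet_of_analyticOnNhd hX hpos ha hF hFm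
  have hInterior : Set.Iio b ⊆ interior (integrableExpSet X μ) := interior_maximal h isOpen_Iio
  refine AnalyticOnNhd.eqOn_of_preconnected_of_eventuallyEq (z₀ := min a b - 1)
      hF (analyticOnNhd_mgf.mono hInterior) isPreconnected_Iio ?_ ?_
  · exact (sub_one_lt _).trans_le (min_le_right a b)
  · have : min a b - 1 < a := by linarith [min_le_left a b]
    filter_upwards [Iio_mem_nhds this] with t ht using hFm t ht

end Landau

/-- `v` is the value at `s` of the (absolutely convergent) transform `∫₁^∞ g(x) x^{-s-1} dx`. -/
def HasTransform (g : ℝ → ℝ) (s v : ℂ) : Prop :=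
  IntegrableOn (fun x : ℝ => (g x : ℂ) * (x : ℂ) ^ (-s - 1)) (Set.Ioi 1) ∧
    ∫ x in Set.Ioi (1 : ℝ), (g x : ℂ) * (x : ℂ) ^ (-s - 1) = v

namespace HasTransform

variable {g h : ℝ → ℝ} {s v w : ℂ}

theorem add (hg : HasTransform g s v) (hh : HasTransform h s w) :
    HasTransform (fun x => g x + h x) s (v + w) := by
  have e : (fun x : ℝ => ((g x + h x : ℝ) : ℂ) * (x : ℂ) ^ (-s - 1)) =
      fun x : ℝ => (g x : ℂ) * (x : ℂ) ^ (-s - 1) + (h x : ℂ) * (x : ℂ) ^ (-s - 1) := by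
    ext x; push_cast; ring
  refine ⟨?_, ?_⟩
  · rw [e]; exact hg.1.add hh.1
  · rw [e, integral_add hg.1 hh.1, hg.2, hh.2]

theorem const_mul (r : ℝ) (hg : HasTransform g s v) :
    HasTransform (fun x => r * g x) s (r * v) := by
  have e : (fun x : ℝ => ((r * g x : ℝ) : ℂ) * (x : ℂ) ^ (-s - 1)) =
      fun x : ℝ => (r : ℂ) * ((g x : ℂ) * (x : ℂ) ^ (-s - 1)) := by
    ext x; push_cast; ring
  refine ⟨?_, ?_⟩
  · rw [e]; exact hg.1.const_mul _
  · rw [e, integral_const_mul, hg.2]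

theorem sum {ι : Type*} (S : Finset ι) {g : ι → ℝ → ℝ} {v : ι → ℂ}
    (hg : ∀ i ∈ S, HasTransform (g i) s (v i)) :
    HasTransform (fun x => ∑ i ∈ S, g i x) s (∑ i ∈ S, v i) := by
  have e : (fun x : ℝ => ((∑ i ∈ S, g i x : ℝ) : ℂ) * (x : ℂ) ^ (-s - 1)) =
      fun x : ℝ => ∑ i ∈ S, (g i x : ℂ) * (x : ℂ) ^ (-s - 1) := by
    ext x; push_cast; rw [Finset.sum_mul]
  refine ⟨?_, ?_⟩
  · rw [e]; exact integrable_finsetSum _ fun i hi => (hg i hi).1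
  · rw [e, integral_finsetSum _ fun i hi => (hg i hi).1]
    exact Finset.sum_congr rfl fun i hi => (hg i hi).2

end HasTransform

theorem integrableOn_pow_mul_cexp {w : ℂ} (hw : 0 < w.re) (j : ℕ) :
    IntegrableOn (fun t : ℝ => (t : ℂ) ^ j * cexp (-w * t)) (Set.Ioi 0) := by
  have h := integrableOn_rpow_mul_exp_neg_mul_rpow (s := (j : ℝ)) (p := 1)
    (by linarith [Nat.cast_nonneg (α := ℝ) j]) one_pos hw
  refine Integrable.mono' h ?_ ?_
  · exact Continuous.aestronglyMeasurable (by fun_prop)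
  · filter_upwards [ae_restrict_mem measurableSet_Ioi] with t ht
    rw [norm_mul, norm_pow, Complex.norm_real, Real.norm_of_nonneg (le_of_lt ht), Complex.norm_exp,
      Real.rpow_natCast, Real.rpow_one]
    simp

theorem integral_pow_mul_cexp {w : ℂ} (hw : 0 < w.re) (j : ℕ) :
    ∫ t in Set.Ioi (0 : ℝ), (t : ℂ) ^ j * cexp (-w * t) = j.factorial / w ^ (j + 1) := by
  have hw0 : w ≠ 0 := by rintro rfl; simp at hw
  induction j with
  | zero =>
    have := integral_exp_mul_complex_Ioi (a := -w) (by simpa using hw) 0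
    simpa using this
  | succ j ih =>
    have hd : ∀ t ∈ Set.Ici (0 : ℝ), HasDerivAt (fun t : ℝ => (t : ℂ) ^ (j + 1) * cexp (-w * t))
        ((j + 1) * ((t : ℂ) ^ j * cexp (-w * t)) - w * ((t : ℂ) ^ (j + 1) * cexp (-w * t))) t := by
      intro t _
      have h0 : HasDerivAt (fun t : ℝ => (t : ℂ)) 1 t := ofRealCLM.hasDerivAt
      have h1 := (h0.pow (j + 1)).mul (h0.const_mul (-w)).cexp
      convert! h1 using 1
      simp only [Nat.add_sub_cancel, Pi.pow_apply]; push_cast; ring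
    have hi := ((integrableOn_pow_mul_cexp hw j).const_mul (j + 1 : ℂ))
    have hi' := ((integrableOn_pow_mul_cexp hw (j + 1)).const_mul w)
    have hlim : Tendsto (fun t : ℝ => (t : ℂ) ^ (j + 1) * cexp (-w * t)) atTop (𝓝 0) := by
      rw [tendsto_zero_iff_norm_tendsto_zero]
      refine (tendsto_rpow_mul_exp_neg_mul_atTop_nhds_zero ((j + 1 : ℕ) : ℝ) w.re hw).congr' ?_
      filter_upwards [eventually_ge_atTop 0] with t ht
      rw [norm_mul, norm_pow, Complex.norm_real, Real.norm_of_nonneg ht, Complex.norm_exp,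
        Real.rpow_natCast]
      simp
    have := integral_Ioi_of_hasDerivAt_of_tendsto' hd (hi.sub hi') hlim
    rw [integral_sub hi hi', integral_const_mul, integral_const_mul, ih] at this
    simp only [ofReal_zero, ne_eq, Nat.add_eq_zero_iff, one_ne_zero, and_false, not_false_eq_true,
      zero_pow, zero_mul, sub_zero] at this
    rw [sub_eq_zero] at this
    rw [eq_div_iff (pow_ne_zero _ hw0), Nat.factorial_succ]
    push_cast
    rw [pow_succ w (j + 1), mul_comm (w ^ (j + 1)) w, ← mul_assoc, mul_comm _ w, ← this]
    field_simp

/-- The transform of `x ^ a * (log x) ^ j`. -/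
theorem hasTransform_rpow_mul_log_pow (a : ℝ) (j : ℕ) {s : ℂ} (hs : a < s.re) :
    HasTransform (fun x => x ^ a * Real.log x ^ j) s (j.factorial / (s - a) ^ (j + 1)) := by
  have himg : Real.exp '' Set.Ioi 0 = Set.Ioi 1 := by
    ext y; constructor
    · rintro ⟨x, hx, rfl⟩; exact Real.one_lt_exp_iff.2 hx
    · intro hy
      exact ⟨Real.log y, Real.log_pos hy, Real.exp_log (zero_lt_one.trans hy)⟩
  have hpt : ∀ t ∈ Set.Ioi (0 : ℝ),
      |Real.exp t| • (((Real.exp t ^ a * Real.log (Real.exp t) ^ j : ℝ) : ℂ)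
      * ((Real.exp t : ℝ) : ℂ) ^ (-s - 1)) = (t : ℂ) ^ j * cexp (-(s - a) * t) := by
    intro t ht
    rw [Real.log_exp, abs_of_pos (Real.exp_pos t), ← Real.exp_mul, cpow_def_of_ne_zero
      (by exact_mod_cast (Real.exp_pos t).ne'), ← ofReal_log (Real.exp_pos t).le, Real.log_exp,
      Complex.real_smul]
    push_cast
    rw [show cexp t * (cexp (t * a) * t ^ j * cexp (t * (-s - 1))) =
      t ^ j * (cexp t * cexp (t * a) * cexp (t * (-s - 1))) by ring, ← Complex.exp_add,
      ← Complex.exp_add]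
    congr 2; ring
  have hw : 0 < (s - a).re := by simpa using hs
  refine ⟨?_, ?_⟩
  · rw [← himg, integrableOn_image_iff_integrableOn_abs_deriv_smul measurableSet_Ioi
      (fun x _ => (Real.hasDerivAt_exp x).hasDerivWithinAt) Real.exp_injective.injOn]
    exact (integrableOn_congr_fun hpt measurableSet_Ioi).2
      (integrableOn_pow_mul_cexp hw j)
  · rw [← himg, integral_image_eq_integral_abs_deriv_smul measurableSet_Ioi
      (fun x _ => (Real.hasDerivAt_exp x).hasDerivWithinAt) Real.exp_injective.injOn,
      setIntegral_congr_fun measurableSet_Ioi hpt, integral_pow_mul_cexp hw]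

/-- The transform of the indicator function of `(1, x₀]`. -/
theorem hasTransform_indicator {x₀ : ℝ} (hx₀ : 1 < x₀) {s : ℂ} (hs : 0 < s.re) :
    HasTransform (Set.indicator (Set.Iic x₀) 1) s ((1 - (x₀ : ℂ) ^ (-s)) / s) := by
  have hs0 : s ≠ 0 := by rintro rfl; simp at hs
  have e : (fun x : ℝ => ((Set.indicator (Set.Iic x₀) (1 : ℝ → ℝ) x : ℝ) : ℂ) * (x : ℂ) ^ (-s - 1)) =
      Set.indicator (Set.Iic x₀) (fun x : ℝ => (x : ℂ) ^ (-s - 1)) := by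
    ext x
    by_cases hx : x ∈ Set.Iic x₀ <;> simp [hx]
  have h0 : (0 : ℝ) ∉ Set.uIcc 1 x₀ := by
    rw [Set.uIcc_of_le hx₀.le]; simp
  have hset : Set.Ioi 1 ∩ Set.Iic x₀ = Set.Ioc 1 x₀ := Set.Ioi_inter_Iic
  refine ⟨?_, ?_⟩
  · rw [e, integrableOn_indicator_iff measurableSet_Iic, Set.inter_comm, hset,
      ← intervalIntegrable_iff_integrableOn_Ioc_of_le hx₀.le]
    exact intervalIntegral.intervalIntegrable_cpow (Or.inr h0)
  · rw [e, setIntegral_indicator measurableSet_Iic, hset,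
      ← intervalIntegral.integral_of_le hx₀.le, integral_cpow (Or.inr ⟨by
        intro h; exact hs0 (by linear_combination -h), h0⟩)]
    simp only [sub_add_cancel, ofReal_one, one_cpow]
    rw [← neg_sub, neg_div_neg_eq]

section
open ProbabilityTheory

/-- Landau's theorem for the transform of a nonnegative function. -/
theorem exists_transform_extension {g : ℝ → ℝ} (hgm : Measurable g)
    (hg : ∀ᵐ x ∂(volume.restrict (Set.Ioi (1 : ℝ))), 0 ≤ g x) {σ₀ b : ℝ} {F : ℝ → ℝ}
    (hT : ∀ σ : ℝ, σ₀ < σ → HasTransform g σ (F σ)) (hF : AnalyticOnNhd ℝ F (Set.Ioi b)) :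
    ∃ G : ℂ → ℂ, DifferentiableOn ℂ G {s | b < s.re} ∧
      (∀ s : ℂ, b < s.re → ‖G s‖ ≤ F s.re) ∧
      ∀ s v : ℂ, HasTransform g s v → G s = v := by
  set d : ℝ → NNReal := fun x => Real.toNNReal (g x / x) with hd
  have hdm : Measurable d := (hgm.div measurable_id).real_toNNReal
  set ν : Measure ℝ := (volume.restrict (Set.Ioi (1 : ℝ))).withDensity (fun x => (d x : ENNReal))
      with hν
  have hdval : ∀ᵐ x ∂(volume.restrict (Set.Ioi (1 : ℝ))), (d x : ℝ) = g x / x := by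
    filter_upwards [hg, ae_restrict_mem measurableSet_Ioi] with x hx hx1
    rw [hd, Real.coe_toNNReal]
    exact div_nonneg hx (zero_lt_one.trans hx1).le
  have hpos : ∀ᵐ x ∂ν, 0 ≤ Real.log x := by
    refine (withDensity_absolutelyContinuous _ _).ae_le ?_
    filter_upwards [ae_restrict_mem measurableSet_Ioi] with x hx
    exact (Real.log_pos hx).le
  have hpt : ∀ s : ℂ, (fun x => d x • cexp (-s * (Real.log x : ℝ)))
      =ᵐ[volume.restrict (Set.Ioi (1 : ℝ))]
      fun x : ℝ => (g x : ℂ) * (x : ℂ) ^ (-s - 1) := by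
    intro s
    filter_upwards [hdval, ae_restrict_mem measurableSet_Ioi] with x hx hx1
    have hx0 : (0 : ℝ) < x := zero_lt_one.trans hx1
    have hxc : (x : ℂ) ≠ 0 := by exact_mod_cast hx0.ne'
    rw [NNReal.smul_def, hx, Complex.real_smul, cpow_sub _ _ hxc, cpow_one, cpow_def_of_ne_zero hxc,
      ofReal_log hx0.le, mul_comm (-s)]
    push_cast; ring
  have hXm : AEMeasurable Real.log ν := Real.measurable_log.aemeasurable
  have hGval : ∀ s v : ℂ, HasTransform g s v → complexMGF Real.log ν (-s) = v := by
    intro s v h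
    rw [complexMGF, hν, integral_withDensity_eq_integral_smul hdm, integral_congr_ae (hpt s), h.2]
  have hmgf : ∀ σ : ℝ, σ₀ < σ → mgf Real.log ν (-σ) = F σ := by
    intro σ hσ
    have := hGval σ _ (hT σ hσ)
    rw [← ofReal_neg, complexMGF_ofReal] at this
    exact_mod_cast this
  have hInterior : ∀ σ : ℝ, σ₀ < σ → -σ ∈ integrableExpSet Real.log ν := by
    intro σ hσ
    have h := (hT σ hσ).1
    have h2 : Integrable (fun x => cexp (-(σ : ℂ) * (Real.log x : ℝ))) ν := by
      rw [hν, integrable_withDensity_iff_integrable_smul hdm]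
      exact h.congr (hpt σ).symm
    have h3 := h2.norm
    change Integrable _ ν
    refine h3.congr (ae_of_all _ fun x => ?_)
    simp only
    rw [Complex.norm_exp]; simp
  have hF' : AnalyticOnNhd ℝ (fun t => F (-t)) (Set.Iio (-b)) := by
    intro t ht
    have h1 : AnalyticAt ℝ F (-t) := hF _ (by simp at ht ⊢; linarith)
    exact h1.fun_comp analyticAt_id.neg
  have ha : Set.Iio (-σ₀) ⊆ integrableExpSet Real.log ν := by
    intro t ht
    have := hInterior (-t) (by simp at ht; linarith)
    simpa using this
  have hFm : ∀ t < -σ₀, F (-t) = mgf Real.log ν t := by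
    intro t ht
    rw [← hmgf (-t) (by linarith), neg_neg]
  have hall := Iio_subset_integrableExpSet_of_analyticOnNhd hXm hpos ha hF' hFm
  have heq := eq_mgf_of_analyticOnNhd hXm hpos ha hF' hFm
  have hinter : Set.Iio (-b) ⊆ interior (integrableExpSet Real.log ν) :=
    interior_maximal hall isOpen_Iio
  refine ⟨fun s => complexMGF Real.log ν (-s), ?_, ?_, fun s v h => hGval s v h⟩
  · intro s hs
    have h1 : AnalyticAt ℂ (complexMGF Real.log ν) (-s) :=
      analyticAt_complexMGF (hinter (by simp at hs ⊢; exact hs))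
    exact (h1.differentiableAt.comp s differentiableAt_id.neg).differentiableWithinAt
  · intro s hs
    refine norm_complexMGF_le_mgf.trans ?_
    rw [← heq _ (by simp; exact hs)]
    simp
end

/-- A function which locally agrees with analytic functions on punctured neighbourhoods can be
corrected to an analytic function. -/
theorem exists_analyticOnNhd_patch {b : ℝ} {F₀ : ℝ → ℝ}
    (h : ∀ x > b, ∃ g : ℝ → ℝ, AnalyticAt ℝ g x ∧ F₀ =ᶠ[𝓝[≠] x] g) :
    ∃ F : ℝ → ℝ, AnalyticOnNhd ℝ F (Set.Ioi b) ∧ ∀ x > b, ContinuousAt F₀ x → F x = F₀ x := by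
  refine ⟨fun x => limUnder (𝓝[≠] x) F₀, ?_, ?_⟩
  · intro x hx
    obtain ⟨g, hg, hge⟩ := h x hx
    refine hg.congr ?_
    have h1 : ∀ᶠ y in 𝓝[≠] x, g y = limUnder (𝓝[≠] y) F₀ := by
      have h2 := eventually_eventually_nhdsWithin.2 hge
      have h3 : ∀ᶠ y in 𝓝[≠] x, ContinuousAt g y :=
        (hg.eventually_analyticAt.filter_mono nhdsWithin_le_nhds).mono fun y hy => hy.continuousAt
      filter_upwards [h2, h3, self_mem_nhdsWithin] with y hy hy' hyx
      symm
      apply Tendsto.limUnder_eq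
      have h5 : F₀ =ᶠ[𝓝 y] g := by
        rwa [IsOpen.nhdsWithin_eq isOpen_compl_singleton hyx] at hy
      exact ((hy'.tendsto).congr' h5.symm).mono_left nhdsWithin_le_nhds
    have h6 : g x = limUnder (𝓝[≠] x) F₀ := by
      symm
      apply Tendsto.limUnder_eq
      exact (hg.continuousAt.tendsto.mono_left nhdsWithin_le_nhds).congr' hge.symm
    exact eventually_nhdsWithin_iff.1 h1 |>.mono fun y hy => by
      by_cases hyx : y = x
      · rw [hyx]; exact h6
      · exact hy hyx
  · intro x hx hc
    exact (hc.tendsto.mono_left nhdsWithin_le_nhds).limUnder_eq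

/-- The Taylor quotient at a zero of order at least `m`. -/
theorem tendsto_div_pow_of_iteratedDeriv_eq_zero {Z : ℂ → ℂ} {ρ : ℂ} (hZ : AnalyticAt ℂ Z ρ) {m : ℕ}
    (h : ∀ j < m, iteratedDeriv j Z ρ = 0) :
    Tendsto (fun s => Z s / (s - ρ) ^ m) (𝓝[≠] ρ) (𝓝 (iteratedDeriv m Z ρ / m.factorial)) := by
  have hp := hZ.hasFPowerSeriesAt
  set p := FormalMultilinearSeries.ofScalars ℂ (fun n ↦ iteratedDeriv n Z ρ / n.factorial)
      with hpdef
  have hcoeff : ∀ n, p.coeff n = iteratedDeriv n Z ρ / n.factorial := by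
    intro n; simp [hpdef, FormalMultilinearSeries.coeff_ofScalars]
  have hq := hp.has_fpower_series_iterate_dslope_fslope m
  have hval : ∀ n, (Function.swap dslope ρ)^[n] Z ρ = iteratedDeriv n Z ρ / n.factorial := by
    intro n
    rw [← (hp.has_fpower_series_iterate_dslope_fslope n).coeff_zero 1, ← hcoeff n]
    change (FormalMultilinearSeries.fslope^[n] p).coeff 0 = _
    rw [FormalMultilinearSeries.coeff_iterate_fslope, zero_add]
  rw [← hval]
  refine (hq.continuousAt.tendsto.mono_left nhdsWithin_le_nhds).congr' ?_
  filter_upwards [self_mem_nhdsWithin] with s hs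
  rw [eq_div_iff (pow_ne_zero _ (sub_ne_zero.2 hs)), mul_comm]
  exact pow_sub_smul_iterate_dslope_of_zero m (fun k hk => by rw [hval, h k hk, zero_div]) s

/-- A one-sided bound for the main part of `f` forces a lower bound for the constant, through a
nonreal zero of `Z` with abscissa `Θ`. -/
theorem le_const_of_ae_le {Z : ℂ → ℂ} (hZd : ∀ s : ℂ, s ≠ 1 → DifferentiableAt ℂ Z s)
    {Θ : ℝ} {ρ : ℂ} (hρ1 : 0 < ρ.re) (hρ2 : ρ.re < 1) (hρim : ρ.im ≠ 0) (hρre : ρ.re = Θ)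
    {m : ℕ} (hm : 1 ≤ m) (hmult : (∀ j : ℕ, j < m → iteratedDeriv j Z ρ = 0))
    (hmult' : iteratedDeriv m Z ρ ≠ 0)
    {A : Finset ℝ} (hA : ∀ x ∈ A, x < 1) {mα : ℝ → ℕ} {c : ℝ → ℕ → ℂ}
    (hc : ∀ x : ℝ, 0 < x → ∃ g : ℂ → ℂ, AnalyticAt ℂ g (x : ℂ) ∧
        ∀ᶠ s in 𝓝[≠] (x : ℂ), 1 / (s * Z s) =
            (∑ a ∈ A, ∑ k ∈ Finset.Icc 1 (mα a), c a k / (s - (a : ℂ)) ^ k) + g s)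
    {f : ℝ → ℝ} (hfm : Measurable f) {C : ℝ} (hfb : ∀ x, 1 ≤ x → |f x| ≤ C * x)
    (hZ0 : ∀ s : ℂ, 1 < s.re → Z s ≠ 0)
    (hft : ∀ s : ℂ, 1 < s.re → HasTransform f s (1 / (s * Z s)))
    {ε : ℝ} (hε : |ε| = 1) {c' x₀ : ℝ} (hx₀ : 1 < x₀)
    (hle : ∀ᵐ x : ℝ, x₀ < x → ε * (f x - ∑ a ∈ A, ∑ k ∈ Finset.Icc 1 (mα a),
      (c a k).re * x ^ a * Real.log x ^ (k - 1) / (Nat.factorial (k - 1))) ≤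
        c' * (x ^ Θ * Real.log x ^ (m - 1))) :
    m / ‖ρ * iteratedDeriv m Z ρ‖ ≤ c' := by
  have hΘ0 : 0 < Θ := hρre ▸ hρ1
  set Mt : ℝ → ℝ := fun x => ∑ a ∈ A, ∑ k ∈ Finset.Icc 1 (mα a),
      (c a k).re * x ^ a * Real.log x ^ (k - 1) / (Nat.factorial (k - 1)) with hMt
  set P : ℂ → ℂ := fun s => ∑ a ∈ A, ∑ k ∈ Finset.Icc 1 (mα a), (c a k).re / (s - (a : ℂ)) ^ k
      with hP
  -- a constant making the function nonnegative on `(1, x₀]`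
  have hMtc : ContinuousOn Mt (Set.Icc 1 x₀) := by
    refine continuousOn_finsetSum _ fun a _ => continuousOn_finsetSum _ fun k _ => ?_
    refine ContinuousOn.div_const (((continuousOn_const).mul ?_).mul ?_) _
    · exact continuousOn_id.rpow_const fun x hx => Or.inl (by linarith [hx.1] : (0:ℝ) < x).ne'
    · exact (Real.continuousOn_log.mono fun x hx => (by linarith [hx.1] : (0:ℝ) < x).ne').pow _
  have hmain : ContinuousOn (fun x : ℝ => c' * (x ^ Θ * Real.log x ^ (m - 1)) + ε * Mt x)
      (Set.Icc 1 x₀) := by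
    refine (continuousOn_const.mul (ContinuousOn.mul ?_ ?_)).add (continuousOn_const.mul hMtc)
    · exact continuousOn_id.rpow_const fun x hx => Or.inl (by linarith [hx.1] : (0:ℝ) < x).ne'
    · exact (Real.continuousOn_log.mono fun x hx => (by linarith [hx.1] : (0:ℝ) < x).ne').pow _
  obtain ⟨B, hB⟩ := isCompact_Icc.exists_bound_of_continuousOn hmain
  set κ : ℝ := B + |C| * x₀ with hκ
  set g : ℝ → ℝ := fun x => c' * (x ^ Θ * Real.log x ^ (m - 1)) + κ * Set.indicator (Set.Iic x₀) 1 x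
    + ((-ε) * f x + ε * Mt x) with hg
  have hMtm : Measurable Mt := by
    refine Finset.measurable_fun_sum _ fun a _ => Finset.measurable_fun_sum _ fun k _ => ?_
    fun_prop
  have hgm : Measurable g := by
    have : Measurable (Set.indicator (Set.Iic x₀) (1 : ℝ → ℝ)) :=
      measurable_one.indicator measurableSet_Iic
    fun_prop
  have hgpos : ∀ᵐ x ∂(volume.restrict (Set.Ioi (1 : ℝ))), 0 ≤ g x := by
    filter_upwards [ae_restrict_of_ae hle, ae_restrict_mem measurableSet_Ioi] with x hx hx1
    have hx1 : 1 < x := hx1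
    by_cases hxx : x₀ < x
    · have := hx hxx
      have h0 : Set.indicator (Set.Iic x₀) (1 : ℝ → ℝ) x = 0 := by simp [hxx]
      simp only [hg, h0]
      linarith
    · push Not at hxx
      have h1 : Set.indicator (Set.Iic x₀) (1 : ℝ → ℝ) x = 1 := by simp [hxx]
      have h2 := hB x ⟨hx1.le, hxx⟩
      rw [Real.norm_eq_abs] at h2
      have h3 : |ε * f x| ≤ |C| * x₀ := by
        rw [abs_mul, hε, one_mul]
        refine (hfb x hx1.le).trans ?_
        have := le_abs_self C
        have := abs_nonneg C
        nlinarith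
      simp only [hg, h1]
      have := neg_abs_le (c' * (x ^ Θ * Real.log x ^ (m - 1)) + ε * Mt x)
      have := le_abs_self (ε * f x)
      linarith
  -- the complex transform
  set R₁ : ℂ → ℂ := fun s => κ * ((1 - (x₀ : ℂ) ^ (-s)) / s) with hR₁
  set R : ℂ → ℂ := fun s => c' * ((m - 1).factorial / (s - Θ) ^ m) + R₁ s + ε * P s with hR
  have hΘ1 : Θ < 1 := hρre ▸ hρ2
  have hTg : ∀ s : ℂ, 1 < s.re → HasTransform g s (R s - ε * (1 / (s * Z s))) := by
    intro s hs
    have t1 := (hasTransform_rpow_mul_log_pow Θ (m - 1) (hΘ1.trans hs)).const_mul c'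
    rw [Nat.sub_add_cancel hm] at t1
    have t2 := (hasTransform_indicator hx₀ (zero_lt_one.trans hs)).const_mul κ
    have t3 := (hft s hs).const_mul (-ε)
    have t4 : HasTransform Mt s (P s) := by
      refine HasTransform.sum A fun a ha => HasTransform.sum _ fun k hk => ?_
      have hk1 := (Finset.mem_Icc.1 hk).1
      have := (hasTransform_rpow_mul_log_pow a (k - 1) ((hA a ha).trans hs)).const_mul
        ((c a k).re / (k - 1).factorial)
      rw [Nat.sub_add_cancel hk1] at this
      have hfac : ((k - 1).factorial : ℂ) ≠ 0 := by exact_mod_cast (k - 1).factorial_ne_zero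
      convert! this using 1
      · ext x; ring
      · push_cast; field_simp
    have := (t1.add t2).add (t3.add (t4.const_mul ε))
    convert! this using 1
    simp only [hR, hR₁]; push_cast; ring
  have hx₀c : (x₀ : ℂ) ≠ 0 := by exact_mod_cast (zero_lt_one.trans hx₀).ne'
  have hR₁d : ∀ s : ℂ, s ≠ 0 → AnalyticAt ℂ R₁ s := by
    intro s hs
    have : DifferentiableOn ℂ R₁ {0}ᶜ := by
      intro z hz
      have hz : z ≠ 0 := hz
      have h1 : DifferentiableAt ℂ (fun s : ℂ => (x₀ : ℂ) ^ (-s)) z :=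
        differentiableAt_id.neg.const_cpow (Or.inl hx₀c)
      exact (((differentiableAt_const _).sub h1).div differentiableAt_id hz
        |>.const_mul _).differentiableWithinAt
    exact this.analyticAt (isOpen_compl_singleton.mem_nhds hs)
  have hRd : ∀ s : ℂ, s.im ≠ 0 → DifferentiableAt ℂ R s := by
    intro s hs
    have hne : ∀ a : ℝ, s - a ≠ 0 := by
      intro a h; rw [sub_eq_zero] at h; rw [h] at hs; simp at hs
    have hs0 : s ≠ 0 := by simpa using hne 0
    have hsub : ∀ (a : ℝ) (k : ℕ) (b : ℂ), DifferentiableAt ℂ (fun s : ℂ => b / (s - a) ^ k) s :=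
      fun a k b => (differentiableAt_const _).div
        ((differentiableAt_id.sub_const _).pow _) (pow_ne_zero _ (hne a))
    refine (((hsub Θ m _).const_mul _).add (hR₁d s hs0).differentiableAt).add ?_
    refine DifferentiableAt.const_mul ?_ _
    exact DifferentiableAt.fun_sum fun a _ => DifferentiableAt.fun_sum fun k _ => hsub a k _
  -- the real continuation
  set F₀ : ℝ → ℝ := fun σ => (R σ - ε * (1 / (σ * Z σ))).re with hF₀
  have hPre : ∀ σ : ℝ, (P σ).re =
      (∑ a ∈ A, ∑ k ∈ Finset.Icc 1 (mα a), c a k / ((σ : ℂ) - a) ^ k).re := by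
    intro σ
    simp only [hP, Complex.re_sum]
    refine Finset.sum_congr rfl fun a _ => Finset.sum_congr rfl fun k _ => ?_
    rw [← ofReal_sub, ← ofReal_pow, Complex.div_ofReal_re, Complex.div_ofReal_re, ofReal_re]
  have hloc : ∀ x : ℝ, 0 < x → ∃ q : ℝ → ℝ, AnalyticAt ℝ q x ∧
      F₀ =ᶠ[𝓝[≠] x] fun σ => c' * ((m - 1).factorial / (σ - Θ) ^ m) + q σ := by
    intro x hx
    obtain ⟨q, hq, hqe⟩ := hc x hx
    refine ⟨fun σ => (R₁ σ - ε * q σ).re, ?_, ?_⟩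
    · exact ((hR₁d x (by exact_mod_cast hx.ne')).sub (analyticAt_const.mul hq)).re_ofReal
    · have ht : Tendsto (fun σ : ℝ => (σ : ℂ)) (𝓝[≠] x) (𝓝[≠] (x : ℂ)) := by
        refine tendsto_nhdsWithin_iff.2 ⟨(continuous_ofReal.tendsto x).mono_left nhdsWithin_le_nhds,
            ?_⟩
        filter_upwards [self_mem_nhdsWithin] with σ hσ
        simpa using hσ
      filter_upwards [ht.eventually hqe] with σ hσ
      have hreal : (((m - 1).factorial : ℂ) / ((σ : ℂ) - Θ) ^ m).re
          = (m - 1).factorial / (σ - Θ) ^ m := by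
        rw [← ofReal_re ((m - 1).factorial / (σ - Θ) ^ m)]; push_cast; rfl
      simp only [hF₀, hR, hσ, Complex.sub_re, Complex.add_re, hreal, Complex.re_ofReal_mul, hPre]
      ring
  obtain ⟨F, hF, hFF₀⟩ := exists_analyticOnNhd_patch (b := Θ) (F₀ := F₀) fun x hx => by
    obtain ⟨q, hq, hqe⟩ := hloc x (hΘ0.trans hx)
    refine ⟨_, ?_, hqe⟩
    refine (analyticAt_const.mul (analyticAt_const.div ((analyticAt_id.sub analyticAt_const).pow _)
        ?_)).add hq
    exact pow_ne_zero _ (sub_ne_zero.2 (ne_of_gt hx))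
  have hFt : ∀ σ : ℝ, 1 < σ → HasTransform g σ (F σ) := by
    intro σ hσ
    have h1 := hTg σ (by simpa using hσ)
    have h2 : ContinuousAt F₀ σ := by
      have hσc : (σ : ℂ) ≠ 1 := by exact_mod_cast hσ.ne'
      have hne : ∀ a : ℝ, a < 1 → (σ : ℂ) - a ≠ 0 := by
        intro a h; rw [sub_ne_zero]; exact_mod_cast (h.trans hσ).ne'
      have hσ0 : (σ : ℂ) ≠ 0 := by simpa using hne 0 one_pos
      have hsub : ∀ (a : ℝ) (k : ℕ) (b : ℂ), a < 1 → ContinuousAt (fun s : ℂ => b / (s - a) ^ k) σ :=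
        fun a k b ha => (continuousAt_const).div
          ((continuousAt_id.sub continuousAt_const).pow _) (pow_ne_zero _ (hne a ha))
      have h3 : ContinuousAt (fun s : ℂ => (R s - ε * (1 / (s * Z s))).re) (σ : ℂ) := by
        refine continuous_re.continuousAt.comp (ContinuousAt.sub ?_ ?_)
        · refine ((continuousAt_const.mul (hsub Θ m _ hΘ1)).add (hR₁d σ hσ0).continuousAt).add ?_
          refine continuousAt_const.mul ?_
          exact tendsto_finsetSum _ fun a ha => tendsto_finsetSum _ fun k _ => hsub a k _ (hA a ha)
        · refine continuousAt_const.mul (continuousAt_const.div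
            (continuousAt_id.mul (hZd _ hσc).continuousAt)
                (mul_ne_zero hσ0 (hZ0 _ (by simpa using hσ))))
      exact h3.comp (f := fun σ : ℝ => (σ : ℂ)) continuous_ofReal.continuousAt
    rw [hFF₀ σ (hΘ1.trans hσ) h2]
    have h3 : R σ - ε * (1 / (σ * Z σ)) = ((F₀ σ : ℝ) : ℂ) := by
      rw [← h1.2]
      have h4 : ∀ x ∈ Set.Ioi (1 : ℝ), (g x : ℂ) * (x : ℂ) ^ (-(σ : ℂ) - 1) =
          ((g x * x ^ (-σ - 1) : ℝ) : ℂ) := by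
        intro x hx
        rw [ofReal_mul, ofReal_cpow (zero_lt_one.trans hx).le]; push_cast; rfl
      have h5 := h1.2
      rw [setIntegral_congr_fun measurableSet_Ioi h4, integral_complex_ofReal] at h5 ⊢
      simp only [hF₀]
      rw [← h5, ofReal_re]
    rwa [h3] at h1
  obtain ⟨G, hGd, hGF, hGT⟩ := exists_transform_extension hgm hgpos hFt hF
  -- the identity on a quadrant
  have hquad : ∀ s : ℂ, Θ < s.re → 0 < ρ.im * s.im → s * Z s * (R s - G s) = ε := by
    have hopen : IsOpen {s : ℂ | Θ < s.re ∧ 0 < ρ.im * s.im} :=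
      (isOpen_lt continuous_const continuous_re).inter
        (isOpen_lt continuous_const (continuous_const.mul continuous_im))
    have hconv : Convex ℝ {s : ℂ | Θ < s.re ∧ 0 < ρ.im * s.im} :=
      (convex_halfSpace_gt (f := Complex.re) reLm.isLinear Θ).inter
        (convex_halfSpace_gt (f := fun s : ℂ => ρ.im * s.im) (ρ.im • imLm).isLinear 0)
    have hd : DifferentiableOn ℂ (fun s => s * Z s * (R s - G s))
        {s : ℂ | Θ < s.re ∧ 0 < ρ.im * s.im} := by
      rintro s ⟨hs1, hs2⟩
      have him : s.im ≠ 0 := by rintro h; simp [h] at hs2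
      have hs1' : s ≠ 1 := by rintro rfl; simp at him
      have hGs : DifferentiableAt ℂ G s :=
        hGd.differentiableAt ((isOpen_lt continuous_const continuous_re).mem_nhds hs1)
      exact ((differentiableAt_id.mul (hZd s hs1')).mul
          ((hRd s him).sub hGs)).differentiableWithinAt
    intro s hs1 hs2
    refine AnalyticOnNhd.eqOn_of_preconnected_of_eventuallyEq (z₀ := 2 + ρ.im * I)
      (hd.analyticOnNhd hopen) (analyticOnNhd_const (v := (ε : ℂ))) hconv.isPreconnected ?_ ?_
      ⟨hs1, hs2⟩
    · simp only [Set.mem_ofPred_eq, add_re, mul_re, add_im, mul_im, ofReal_re, ofReal_im, I_re,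
          I_im]
      simp only [re_ofNat, im_ofNat]
      constructor
      · linarith
      · have := mul_self_pos.2 hρim
        linarith
    · have : IsOpen {s : ℂ | 1 < s.re} := isOpen_lt continuous_const continuous_re
      filter_upwards [this.mem_nhds (show 1 < (2 + ρ.im * I : ℂ).re by simp)] with z hz
      have hz0 : z ≠ 0 := by rintro rfl; simp at hz; linarith
      rw [hGT z _ (hTg z hz)]
      have := hZ0 z hz
      field_simp
      ring
  -- compare the growth along `Im s = Im ρ`
  have hZρ : AnalyticAt ℂ Z ρ := by
    have : DifferentiableOn ℂ Z {1}ᶜ := fun s hs => (hZd s hs).differentiableWithinAt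
    refine this.analyticAt (isOpen_compl_singleton.mem_nhds ?_)
    rintro rfl; simp at hρim
  have hρ0 : ρ ≠ 0 := by rintro rfl; simp at hρ1
  set φ : ℝ → ℂ := fun σ => σ + ρ.im * I with hφ
  have hφρ : ∀ σ, φ σ - ρ = ((σ - Θ : ℝ) : ℂ) := by
    intro σ; apply Complex.ext <;> simp [hφ, hρre]
  have hφt : Tendsto φ (𝓝[>] Θ) (𝓝[≠] ρ) := by
    refine tendsto_nhdsWithin_iff.2 ⟨?_, ?_⟩
    · have : Continuous φ := by fun_prop
      have h := (this.tendsto Θ).mono_left (nhdsWithin_le_nhds (s := Set.Ioi Θ))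
      rwa [← sub_eq_zero.1 ((hφρ Θ).trans (by simp))]
    · filter_upwards [self_mem_nhdsWithin] with σ hσ
      have hσ : Θ < σ := hσ
      rw [Set.mem_compl_singleton_iff, ← sub_ne_zero, hφρ]
      exact_mod_cast (sub_pos.2 hσ).ne'
  obtain ⟨q, hq, hqe⟩ := hloc Θ hΘ0
  have hlim0 : Tendsto (fun σ : ℝ => (σ - Θ) ^ m) (𝓝[>] Θ) (𝓝 0) := by
    have : Continuous fun σ : ℝ => (σ - Θ) ^ m := by fun_prop
    have h := (this.tendsto Θ).mono_left (nhdsWithin_le_nhds (s := Set.Ioi Θ))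
    simpa [(Nat.one_le_iff_ne_zero.1 hm)] using h
  have hRHS : Tendsto (fun σ : ℝ => (σ - Θ) ^ m * F σ) (𝓝[>] Θ) (𝓝 (c' * (m - 1).factorial)) := by
    have h1 : Tendsto (fun σ : ℝ => c' * (m - 1).factorial + (σ - Θ) ^ m * q σ) (𝓝[>] Θ)
        (𝓝 (c' * (m - 1).factorial + 0 * q Θ)) :=
      tendsto_const_nhds.add (hlim0.mul (hq.continuousAt.tendsto.mono_left nhdsWithin_le_nhds))
    rw [zero_mul, add_zero] at h1
    refine h1.congr' ?_
    have hev := (eventually_eventually_nhdsWithin.2 hqe).filter_mono (nhdsGT_le_nhdsNE Θ)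
    have hqc := hq.eventually_analyticAt.filter_mono (nhdsWithin_le_nhds (s := Set.Ioi Θ))
    filter_upwards [hev, hqc, self_mem_nhdsWithin] with σ h2 h3 hσ
    have hσ : Θ < σ := hσ
    rw [IsOpen.nhdsWithin_eq isOpen_compl_singleton hσ.ne'] at h2
    have hne : (σ - Θ) ^ m ≠ 0 := pow_ne_zero _ (sub_pos.2 hσ).ne'
    have h4 : ContinuousAt F₀ σ := by
      refine ContinuousAt.congr ?_ (EventuallyEq.symm h2)
      exact (continuousAt_const.mul (continuousAt_const.div
        ((continuousAt_id.sub continuousAt_const).pow _) hne)).add h3.continuousAt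
    rw [hFF₀ σ hσ h4, h2.self_of_nhds]
    field_simp
  have hLHS : Tendsto (fun σ : ℝ => (σ - Θ) ^ m * ‖G (φ σ)‖) (𝓝[>] Θ)
      (𝓝 (m.factorial / ‖ρ * iteratedDeriv m Z ρ‖)) := by
    have h1 := (tendsto_div_pow_of_iteratedDeriv_eq_zero hZρ hmult).comp hφt
    have hid : Tendsto φ (𝓝[>] Θ) (𝓝 ρ) := hφt.mono_right nhdsWithin_le_nhds
    have hfac : (m.factorial : ℂ) ≠ 0 := by exact_mod_cast m.factorial_ne_zero
    have h2 : Tendsto (fun σ => ‖(((σ - Θ) ^ m : ℝ) : ℂ) * R (φ σ) - ε /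
        (φ σ * (Z (φ σ) / (φ σ - ρ) ^ m))‖)
        (𝓝[>] Θ) (𝓝 ‖((0 : ℝ) : ℂ) * R ρ - ε / (ρ * (iteratedDeriv m Z ρ / m.factorial))‖) := by
      refine Tendsto.norm (Tendsto.sub ?_ ?_)
      · exact ((continuous_ofReal.tendsto 0).comp hlim0).mul
            ((hRd ρ hρim).continuousAt.tendsto.comp hid)
      · exact tendsto_const_nhds.div (hid.mul h1) (mul_ne_zero hρ0 (div_ne_zero hmult' hfac))
    have h3 : ‖((0 : ℝ) : ℂ) * R ρ - ε / (ρ * (iteratedDeriv m Z ρ / m.factorial))‖ =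
        m.factorial / ‖ρ * iteratedDeriv m Z ρ‖ := by
      rw [ofReal_zero, zero_mul, zero_sub, norm_neg, norm_div, Complex.norm_real, Real.norm_eq_abs,
          hε,
        ← mul_div_assoc, norm_div, one_div_div, Complex.norm_natCast]
    rw [h3] at h2
    refine h2.congr' ?_
    filter_upwards [self_mem_nhdsWithin] with σ hσ
    have hσ : Θ < σ := hσ
    have h4 := hquad (φ σ) (by simpa [hφ] using hσ) (by simpa [hφ] using mul_self_pos.2 hρim)
    have hεc : (ε : ℂ) ≠ 0 := by
      have : ε ≠ 0 := by rintro rfl; simp at hε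
      exact_mod_cast this
    have hsZ : φ σ * Z (φ σ) ≠ 0 := by
      intro h; rw [h, zero_mul] at h4; exact hεc h4.symm
    have hp : 0 < σ - Θ := sub_pos.2 hσ
    have hpc : ((σ - Θ : ℝ) : ℂ) ≠ 0 := by exact_mod_cast hp.ne'
    have h5 : (((σ - Θ) ^ m : ℝ) : ℂ) * R (φ σ) - ε / (φ σ * (Z (φ σ) / (φ σ - ρ) ^ m))
        = (((σ - Θ) ^ m : ℝ) : ℂ) * G (φ σ) := by
      rw [hφρ, ← h4, ofReal_pow]
      have := left_ne_zero_of_mul hsZ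
      have := right_ne_zero_of_mul hsZ
      field_simp
      ring
    rw [h5, norm_mul, Complex.norm_real, Real.norm_of_nonneg (pow_pos hp m).le]
  have hfin : m.factorial / ‖ρ * iteratedDeriv m Z ρ‖ ≤ c' * (m - 1).factorial := by
    refine le_of_tendsto_of_tendsto hLHS hRHS ?_
    filter_upwards [self_mem_nhdsWithin] with σ hσ
    have hσ : Θ < σ := hσ
    have h1 := hGF (φ σ) (by simpa [hφ] using hσ)
    have h2 : (φ σ).re = σ := by simp [hφ]
    rw [h2] at h1
    exact mul_le_mul_of_nonneg_left h1 (pow_pos (sub_pos.2 hσ) m).le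
  rw [← Nat.mul_factorial_pred (Nat.one_le_iff_ne_zero.1 hm), Nat.cast_mul,
      mul_div_right_comm] at hfin
  exact le_of_mul_le_mul_right hfin (by exact_mod_cast (m - 1).factorial_pos)

section LatticeCounting

open Module Pointwise

variable {E ι : Type*} [NormedAddCommGroup E] [NormedSpace ℝ E] [FiniteDimensional ℝ E]
  [MeasurableSpace E] [BorelSpace E] [Finite ι]

theorem card_mul_measure_fundamentalDomain_le (b : Basis ι ℝ E) (μ : Measure E)
    [μ.IsAddHaarMeasure] {A : Finset E} (hA : ∀ x ∈ A, x ∈ Submodule.span ℤ (Set.range b))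
    {T : Set E} (hT : ∀ x ∈ A, ∀ p ∈ ZSpan.fundamentalDomain b, x + p ∈ T) :
    A.card * μ (ZSpan.fundamentalDomain b) ≤ μ T := by
  have hmeas : ∀ x : E, MeasurableSet (x +ᵥ ZSpan.fundamentalDomain b) := fun x ↦
    (ZSpan.fundamentalDomain_measurableSet b).const_vadd x
  have hdisj : (A : Set E).PairwiseDisjoint fun x ↦ x +ᵥ ZSpan.fundamentalDomain b := by
    intro x hx y hy hxy
    refine Set.disjoint_left.2 ?_
    rintro _ ⟨p, hp, rfl⟩ ⟨q, hq, hpq⟩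
    have := Fintype.ofFinite ι
    have h1 := ZSpan.fract_zSpan_add b p (hA x hx)
    have h2 := ZSpan.fract_zSpan_add b q (hA y hy)
    simp only [vadd_eq_add] at hpq
    rw [hpq, h1, ZSpan.fract_eq_self.2 hp, ZSpan.fract_eq_self.2 hq] at h2
    exact hxy (by rw [h2] at hpq; exact (add_right_cancel hpq).symm)
  calc (A.card : ENNReal) * μ (ZSpan.fundamentalDomain b)
      = ∑ x ∈ A, μ (x +ᵥ ZSpan.fundamentalDomain b) := by simp
    _ = μ (⋃ x ∈ A, x +ᵥ ZSpan.fundamentalDomain b) :=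
        (measure_biUnion_finset hdisj fun x _ ↦ hmeas x).symm
    _ ≤ μ T := by
        refine measure_mono (Set.iUnion₂_subset fun x hx ↦ ?_)
        rintro _ ⟨p, hp, rfl⟩
        exact hT x hx p hp

theorem measure_le_card_mul_measure_fundamentalDomain (b : Basis ι ℝ E) (μ : Measure E)
    [μ.IsAddHaarMeasure] {A : Finset E} {U : Set E}
    (hU : ∀ y ∈ U, ∀ p ∈ ZSpan.fundamentalDomain b,
      y - p ∈ Submodule.span ℤ (Set.range b) → y - p ∈ A) :
    μ U ≤ A.card * μ (ZSpan.fundamentalDomain b) := by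
  have := Fintype.ofFinite ι
  calc μ U ≤ μ (⋃ x ∈ A, x +ᵥ ZSpan.fundamentalDomain b) := by
        refine measure_mono fun y hy ↦ ?_
        have h := hU y hy (ZSpan.fract b y) (ZSpan.fract_mem_fundamentalDomain b y)
          (by rw [ZSpan.fract_apply, sub_sub_cancel]; exact SetLike.coe_mem _)
        exact Set.mem_iUnion₂.2 ⟨_, h, ZSpan.fract b y, ZSpan.fract_mem_fundamentalDomain b y,
          by simp⟩
    _ ≤ ∑ x ∈ A, μ (x +ᵥ ZSpan.fundamentalDomain b) := measure_biUnion_finset_le _ _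
    _ = A.card * μ (ZSpan.fundamentalDomain b) := by simp

end LatticeCounting

variable {K : Type} [Field K] [NumberField K]

theorem moebiusK_eq_moebius (I : Ideal (𝓞 K)) :
    moebiusK K I = UniqueFactorizationMonoid.moebius I := rfl

theorem abs_moebiusK_le (I : Ideal (𝓞 K)) : |(moebiusK K I : ℝ)| ≤ 1 := by
  unfold moebiusK
  split_ifs <;> simp

/-- The sum of the Möbius function over the divisors of an ideal. -/
theorem sum_moebiusK_divisors {L : Ideal (𝓞 K)} (hL : L ≠ ⊥) (s : Finset (Ideal (𝓞 K)))
    (hs : ∀ J, J ∈ s ↔ J ∣ L) : ∑ J ∈ s, moebiusK K J = if L = 1 then 1 else 0 := by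
  split_ifs with h
  · subst h
    have : s = {1} := by
      ext J
      rw [hs, Finset.mem_singleton, ← isUnit_iff_dvd_one, Ideal.isUnit_iff, Ideal.one_eq_top]
    rw [this, Finset.sum_singleton, moebiusK_eq_moebius, UniqueFactorizationMonoid.moebius_one]
  · obtain ⟨P, hP, hPL⟩ := WfDvdMonoid.exists_irreducible_factor
      (fun hu ↦ h (by rwa [Ideal.isUnit_iff, ← Ideal.one_eq_top] at hu)) hL
    have hPp : Prime P := hP.prime
    set t := s.filter (fun J ↦ Squarefree J) with ht
    have h1 : ∑ J ∈ s, moebiusK K J = ∑ J ∈ t, moebiusK K J := by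
      refine (Finset.sum_filter_of_ne fun J _ hJ ↦ ?_).symm
      by_contra hsq
      exact hJ (UniqueFactorizationMonoid.moebius_of_not_squarefree hsq)
    have h2 : t.filter (fun J ↦ P ∣ J) = (t.filter (fun J ↦ ¬ P ∣ J)).image (P * ·) := by
      ext J
      simp only [ht, Finset.mem_filter, Finset.mem_image, hs]
      constructor
      · rintro ⟨⟨hJ, hsq⟩, I, rfl⟩
        refine ⟨I, ⟨⟨(Dvd.intro_left _ rfl).trans hJ, hsq.of_mul_right⟩, fun hPI ↦ ?_⟩, rfl⟩
        exact hP.not_isUnit (hsq P (mul_dvd_mul_left P hPI))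
      · rintro ⟨I, ⟨⟨hI, hsq⟩, hPI⟩, rfl⟩
        have hrel : IsRelPrime P I := hP.isRelPrime_iff_not_dvd.2 hPI
        exact ⟨⟨hrel.mul_dvd hPL hI, (squarefree_mul_iff).2 ⟨hrel, hP.squarefree, hsq⟩⟩,
          dvd_mul_right _ _⟩
    rw [h1, ← Finset.sum_filter_add_sum_filter_not t (fun J ↦ P ∣ J), h2,
      Finset.sum_image fun I _ J _ hIJ ↦ mul_left_cancel₀ hP.ne_zero hIJ,
      ← Finset.sum_add_distrib]
    refine Finset.sum_eq_zero fun J hJ ↦ ?_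
    have hPJ := (Finset.mem_filter.1 hJ).2
    rw [moebiusK_eq_moebius, moebiusK_eq_moebius,
      (hP.isRelPrime_iff_not_dvd.2 hPJ).moebius_mul, hP.moebius_eq]
    ring

variable (K) in
/-- The ideals of given norm. -/
def idealsOfNorm (n : ℕ) : Finset (Ideal (𝓞 K)) :=
  (Ideal.finite_setOfPred_absNorm_eq (S := 𝓞 K) n).toFinset

@[simp]
theorem mem_idealsOfNorm {n : ℕ} {I : Ideal (𝓞 K)} :
    I ∈ idealsOfNorm K n ↔ Ideal.absNorm I = n := by
  simp [idealsOfNorm]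

variable (K) in
/-- The number of nonzero ideals of norm at most `t`. -/
def idealCount (t : ℝ) : ℝ := ∑ k ∈ Finset.Icc 1 ⌊t⌋₊, ((idealsOfNorm K k).card : ℝ)

variable (K) in
/-- The right-continuous version of the Mertens function. -/
def mertensSum (t : ℝ) : ℝ :=
  ∑ k ∈ Finset.Icc 1 ⌊t⌋₊, ∑ I ∈ idealsOfNorm K k, (moebiusK K I : ℝ)

theorem idealCount_eq_card (t : ℝ) :
    idealCount K t =
      Nat.card {I : nonZeroDivisors (Ideal (𝓞 K)) // (Ideal.absNorm (I : Ideal (𝓞 K)) : ℝ) ≤ t} := by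
  have h1 : idealCount K t =
      (((Finset.Icc 1 ⌊t⌋₊).biUnion (idealsOfNorm K)).card : ℝ) := by
    rw [Finset.card_biUnion, idealCount]
    · push_cast; rfl
    · intro i _ j _ hij
      refine Finset.disjoint_left.2 fun I hI hJ ↦ hij ?_
      rw [mem_idealsOfNorm] at hI hJ
      rw [← hI, hJ]
  rw [h1, Nat.cast_inj, ← Nat.card_eq_finsetCard]
  refine Nat.card_congr ⟨fun I ↦ ⟨⟨I.1, ?_⟩, ?_⟩, fun I ↦ ⟨I.1, ?_⟩, fun _ ↦ rfl, fun _ ↦ rfl⟩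
  · have := I.2
    simp only [Finset.mem_biUnion, Finset.mem_Icc, mem_idealsOfNorm] at this
    obtain ⟨n, ⟨hn, -⟩, hI⟩ := this
    refine mem_nonZeroDivisors_of_ne_zero fun h ↦ ?_
    rw [h] at hI
    simp at hI
    omega
  · have := I.2
    simp only [Finset.mem_biUnion, Finset.mem_Icc, mem_idealsOfNorm] at this
    obtain ⟨n, ⟨hn, hn'⟩, hI⟩ := this
    rw [hI]
    exact (Nat.le_floor_iff' (by omega)).1 hn'
  · simp only [Finset.mem_biUnion, Finset.mem_Icc, mem_idealsOfNorm]
    have h0 : Ideal.absNorm (I.1 : Ideal (𝓞 K)) ≠ 0 := by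
      simpa [Ideal.absNorm_eq_zero_iff] using nonZeroDivisors.ne_zero I.1.2
    exact ⟨_, ⟨Nat.one_le_iff_ne_zero.2 h0, (Nat.le_floor_iff' h0).2 I.2⟩, rfl⟩

variable (K) in
theorem exists_idealCount_le : ∃ C : ℝ, ∀ t : ℝ, 1 ≤ t → idealCount K t ≤ C * t := by
  have h := Ideal.tendsto_norm_le_div_atTop₀ K
  simp_rw [← idealCount_eq_card] at h
  obtain ⟨T, hT⟩ := (h.eventually_le_const (lt_add_one _)).exists_forall_of_atTop
  set κ := (2 ^ InfinitePlace.nrRealPlaces K * (2 * Real.pi) ^ InfinitePlace.nrComplexPlaces K *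
    Units.regulator K * classNumber K) / (Units.torsionOrder K * Real.sqrt |discr K|) + 1 with hκ
  have hmono : Monotone (idealCount K) := fun s t hst ↦
    Finset.sum_le_sum_of_subset_of_nonneg (Finset.Icc_subset_Icc_right (Nat.floor_mono hst))
      fun _ _ _ ↦ Nat.cast_nonneg _
  have hnn : ∀ t, 0 ≤ idealCount K t := fun t ↦ Finset.sum_nonneg fun _ _ ↦ Nat.cast_nonneg _
  refine ⟨|κ| + idealCount K T, fun t ht ↦ ?_⟩
  rcases le_total T t with h | h
  · have := hT t h
    rw [div_le_iff₀ (by linarith)] at this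
    nlinarith [le_abs_self κ, hnn T]
  · have := hmono h
    nlinarith [abs_nonneg κ, hnn T]

theorem abs_mertensSum_le (t : ℝ) : |mertensSum K t| ≤ idealCount K t := by
  refine (Finset.abs_sum_le_sum_abs _ _).trans (Finset.sum_le_sum fun k _ ↦ ?_)
  refine (Finset.abs_sum_le_sum_abs _ _).trans ?_
  refine (Finset.sum_le_sum fun I _ ↦ abs_moebiusK_le I).trans ?_
  simp

variable (K) in
theorem measurable_mertensSum : Measurable (mertensSum K) :=
  (measurable_from_nat (f := fun n ↦ ∑ k ∈ Finset.Icc 1 n, ∑ I ∈ idealsOfNorm K k,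
    (moebiusK K I : ℝ))).comp Nat.measurable_floor

variable (K) in
theorem measurable_idealCount : Measurable (idealCount K) :=
  (measurable_from_nat (f := fun n ↦ ∑ k ∈ Finset.Icc 1 n,
    ((idealsOfNorm K k).card : ℝ))).comp Nat.measurable_floor

theorem mertensK_eq_mertensSum {x : ℝ} (hx : ∀ n : ℕ, (n : ℝ) ≠ x) :
    mertensK K x = mertensSum K x := by
  have h : mertensK K x = ∑' I : Ideal (𝓞 K), if I ∈ (Finset.Icc 1 ⌊x⌋₊).biUnion (idealsOfNorm K)
      then (moebiusK K I : ℝ) else 0 := by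
    refine tsum_congr fun I ↦ ?_
    rw [if_neg (c := I ≠ ⊥ ∧ (Ideal.absNorm I : ℝ) = x) fun h ↦ hx _ h.2]
    refine if_congr ?_ rfl rfl
    simp only [Finset.mem_biUnion, Finset.mem_Icc, mem_idealsOfNorm]
    rw [ne_eq, ← Ideal.absNorm_eq_zero_iff]
    constructor
    · rintro ⟨h1, h2⟩
      exact ⟨_, ⟨Nat.one_le_iff_ne_zero.2 h1, (Nat.le_floor_iff' h1).2 h2.le⟩, rfl⟩
    · rintro ⟨n, ⟨h1, h2⟩, h⟩
      rw [h]
      exact ⟨by omega, lt_of_le_of_ne ((Nat.le_floor_iff' (by omega)).1 h2) (hx n)⟩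
  rw [h, tsum_eq_sum (s := (Finset.Icc 1 ⌊x⌋₊).biUnion (idealsOfNorm K))
    fun I hI ↦ if_neg hI, Finset.sum_congr rfl fun I hI ↦ if_pos hI, mertensSum,
    Finset.sum_biUnion]
  intro i _ j _ hij
  refine Finset.disjoint_left.2 fun I hI hJ ↦ hij ?_
  rw [mem_idealsOfNorm] at hI hJ
  rw [← hI, hJ]

variable (K) in
theorem ae_mertensK_eq_mertensSum : ∀ᵐ x : ℝ, mertensK K x = mertensSum K x := by
  have : (Set.range ((↑) : ℕ → ℝ)).Countable := Set.countable_range _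
  filter_upwards [compl_mem_ae_iff.2 (this.measure_zero volume)] with x hx
  exact mertensK_eq_mertensSum fun n hn ↦ hx ⟨n, hn⟩

theorem isBigO_sum_norm {g : Ideal (𝓞 K) → ℂ} (hg : ∀ I, ‖g I‖ ≤ 1) :
    (fun n : ℕ ↦ ∑ k ∈ Finset.Icc 1 n, ‖∑ I ∈ idealsOfNorm K k, g I‖) =O[atTop]
      fun n ↦ (n : ℝ) ^ (1 : ℝ) := by
  obtain ⟨C, hC⟩ := exists_idealCount_le K
  refine Asymptotics.IsBigO.of_bound C ?_
  filter_upwards [eventually_ge_atTop 1] with n hn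
  have h1 : ∑ k ∈ Finset.Icc 1 n, ‖∑ I ∈ idealsOfNorm K k, g I‖ ≤ idealCount K n := by
    rw [idealCount, Nat.floor_natCast]
    refine Finset.sum_le_sum fun k _ ↦ (norm_sum_le _ _).trans ?_
    refine (Finset.sum_le_sum fun I _ ↦ hg I).trans ?_
    simp
  rw [Real.norm_of_nonneg (by positivity), Real.rpow_one, Real.norm_of_nonneg (by positivity)]
  exact h1.trans (hC n (by exact_mod_cast hn))

theorem summable_absNorm_cpow {s : ℂ} (hs : 1 < s.re) :
    Summable fun I : Ideal (𝓞 K) ↦ ‖(Ideal.absNorm I : ℂ) ^ (-s)‖ := by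
  have hs0 : s ≠ 0 := by rintro rfl; simp at hs; linarith
  have h1 := (LSeriesSummable_of_sum_norm_bigO (isBigO_sum_norm (K := K) (g := fun _ ↦ 1)
    (by simp)) zero_le_one hs).norm
  refine summable_of_sum_le (c := ∑' n, ‖LSeries.term
    (fun k ↦ ∑ I ∈ idealsOfNorm K k, (1 : ℂ)) s n‖) (fun _ ↦ norm_nonneg _) fun T ↦ ?_
  refine le_trans ?_ (h1.sum_le_tsum (T.image Ideal.absNorm) fun _ _ ↦ norm_nonneg _)
  rw [← Finset.sum_fiberwise_of_maps_to (t := T.image Ideal.absNorm) (g := Ideal.absNorm)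
    fun I hI ↦ Finset.mem_image_of_mem _ hI]
  refine Finset.sum_le_sum fun n _ ↦ ?_
  calc _ = ∑ I ∈ T with Ideal.absNorm I = n, ‖(n : ℂ) ^ (-s)‖ :=
        Finset.sum_congr rfl fun I hI ↦ by rw [(Finset.mem_filter.1 hI).2]
    _ ≤ ∑ I ∈ idealsOfNorm K n, ‖(n : ℂ) ^ (-s)‖ :=
        Finset.sum_le_sum_of_subset_of_nonneg (fun I hI ↦ by simpa using (Finset.mem_filter.1 hI).2)
          fun _ _ _ ↦ norm_nonneg _
    _ = _ := by
        rcases eq_or_ne n 0 with rfl | hn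
        · simp [hs0]
        · rw [LSeries.term_of_ne_zero hn, norm_div, cpow_neg, norm_inv]
          simp [div_eq_mul_inv]

theorem tsum_eq_LSeries {g : Ideal (𝓞 K) → ℂ} (hg : ∀ I, ‖g I‖ ≤ 1) {s : ℂ} (hs : 1 < s.re) :
    ∑' I : Ideal (𝓞 K), g I * (Ideal.absNorm I : ℂ) ^ (-s) =
      LSeries (fun n ↦ ∑ I ∈ idealsOfNorm K n, g I) s := by
  have hs0 : s ≠ 0 := by rintro rfl; simp at hs; linarith
  have hS : Summable fun I : Ideal (𝓞 K) ↦ g I * (Ideal.absNorm I : ℂ) ^ (-s) := by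
    refine .of_norm_bounded (summable_absNorm_cpow hs) fun I ↦ ?_
    rw [norm_mul]
    exact mul_le_of_le_one_left (norm_nonneg _) (hg I)
  rw [← (hS.hasSum.tsum_fiberwise Ideal.absNorm).tsum_eq, LSeries]
  refine tsum_congr fun n ↦ ?_
  have : Ideal.absNorm ⁻¹' {n} = (idealsOfNorm K n : Set (Ideal (𝓞 K))) := by ext; simp
  rw [this, Finset.tsum_subtype' (idealsOfNorm K n)
    fun I ↦ g I * (Ideal.absNorm I : ℂ) ^ (-s)]
  rw [Finset.sum_congr rfl fun I hI ↦ by rw [mem_idealsOfNorm.1 hI], ← Finset.sum_mul]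
  rcases eq_or_ne n 0 with rfl | hn
  · simp [hs0]
  · rw [LSeries.term_of_ne_zero hn, cpow_neg, div_eq_mul_inv]

theorem tsum_mul_tsum_moebiusK {s : ℂ} (hs : 1 < s.re) :
    (∑' I : Ideal (𝓞 K), (1 : ℂ) * (Ideal.absNorm I : ℂ) ^ (-s)) *
      (∑' I : Ideal (𝓞 K), (moebiusK K I : ℂ) * (Ideal.absNorm I : ℂ) ^ (-s)) = 1 := by
  have hs0 : s ≠ 0 := by rintro rfl; simp at hs; linarith
  simp only [one_mul]
  have hμ : Summable fun I : Ideal (𝓞 K) ↦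
      ‖(moebiusK K I : ℂ) * (Ideal.absNorm I : ℂ) ^ (-s)‖ := by
    refine .of_nonneg_of_le (fun _ ↦ norm_nonneg _) (fun I ↦ ?_) (summable_absNorm_cpow hs)
    rw [norm_mul]
    refine mul_le_of_le_one_left (norm_nonneg _) ?_
    simpa using abs_moebiusK_le I
  have hS := summable_mul_of_summable_norm (summable_absNorm_cpow (K := K) hs) hμ
  rw [tsum_mul_tsum_of_summable_norm (summable_absNorm_cpow hs) hμ,
    ← (hS.hasSum.tsum_fiberwise fun p : Ideal (𝓞 K) × Ideal (𝓞 K) ↦ p.1 * p.2).tsum_eq]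
  refine (tsum_congr fun L ↦ ?_).trans (tsum_ite_eq (1 : Ideal (𝓞 K)) fun _ ↦ (1 : ℂ))
  rcases eq_or_ne L ⊥ with rfl | hL
  · rw [if_neg (by rw [Ideal.one_eq_top]; exact bot_ne_top)]
    refine (tsum_congr fun p ↦ ?_).trans tsum_zero
    have hp : (p.1.1 * p.1.2 : Ideal (𝓞 K)) = ⊥ := p.2
    rcases Ideal.mul_eq_bot.1 hp with h | h <;> simp [h, hs0]
  · have hfin : {J : Ideal (𝓞 K) | J ∣ L}.Finite := by
      refine (Ideal.finite_setOfPred_absNorm_le (S := 𝓞 K) (Ideal.absNorm L)).subset fun J hJ ↦ ?_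
      exact Nat.le_of_dvd (Nat.pos_of_ne_zero (by rwa [ne_eq, Ideal.absNorm_eq_zero_iff]))
        (map_dvd Ideal.absNorm hJ)
    let φ : ((fun p : Ideal (𝓞 K) × Ideal (𝓞 K) ↦ p.1 * p.2) ⁻¹' {L}) →
        (hfin.toFinset : Set (Ideal (𝓞 K))) := fun p ↦ ⟨p.1.2, by
      have hp : p.1.1 * p.1.2 = L := p.2
      simpa using Dvd.intro_left _ hp⟩
    have hφ : Function.Bijective φ := by
      constructor
      · rintro ⟨⟨I, J⟩, hp⟩ ⟨⟨I', J'⟩, hp'⟩ h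
        simp only [Set.mem_preimage, Set.mem_singleton_iff] at hp hp'
        have hJ : J = J' := congrArg Subtype.val h
        subst hJ
        have hJ0 : J ≠ 0 := by rintro rfl; exact hL (by rw [← hp, mul_zero]; rfl)
        have : I = I' := mul_right_cancel₀ hJ0 (hp.trans hp'.symm)
        subst this
        rfl
      · rintro ⟨J, hJ⟩
        obtain ⟨I, hI⟩ : J ∣ L := by simpa using hJ
        exact ⟨⟨⟨I, J⟩, by simp [hI, mul_comm]⟩, rfl⟩
    have hterm (p : (fun p : Ideal (𝓞 K) × Ideal (𝓞 K) ↦ p.1 * p.2) ⁻¹' {L}) :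
        (Ideal.absNorm p.1.1 : ℂ) ^ (-s) * ((moebiusK K p.1.2 : ℂ) *
          (Ideal.absNorm p.1.2 : ℂ) ^ (-s)) =
        (moebiusK K (φ p : Ideal (𝓞 K)) : ℂ) * (Ideal.absNorm L : ℂ) ^ (-s) := by
      have hp : p.1.1 * p.1.2 = L := p.2
      have hN : (Ideal.absNorm L : ℂ) ^ (-s) =
          (Ideal.absNorm p.1.1 : ℂ) ^ (-s) * (Ideal.absNorm p.1.2 : ℂ) ^ (-s) := by
        rw [← natCast_mul_natCast_cpow, ← Nat.cast_mul, ← map_mul, hp]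
      rw [hN]
      ring
    rw [tsum_congr hterm]
    refine ((Equiv.ofBijective φ hφ).tsum_eq fun J : (hfin.toFinset : Set (Ideal (𝓞 K))) ↦
        (moebiusK K (J : Ideal (𝓞 K)) : ℂ) * (Ideal.absNorm L : ℂ) ^ (-s)).trans ?_
    rw [Finset.tsum_subtype' hfin.toFinset
        fun J ↦ (moebiusK K J : ℂ) * (Ideal.absNorm L : ℂ) ^ (-s),
      ← Finset.sum_mul, ← Int.cast_sum, sum_moebiusK_divisors hL hfin.toFinset (by simp)]
    split_ifs with h
    · simp [h]
    · simp

theorem _root_.IsDedekindZeta.eq_LSeries {Z : ℂ → ℂ} (hZ : IsDedekindZeta K Z) {s : ℂ}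
    (hs : 1 < s.re) :
    Z s = LSeries (fun n ↦ ∑ _I ∈ idealsOfNorm K n, (1 : ℂ)) s := by
  have hs0 : s ≠ 0 := by rintro rfl; simp at hs; linarith
  rw [hZ.2 s hs, ← tsum_eq_LSeries (by simp) hs]
  simp only [one_mul]
  refine tsum_subtype_eq_of_support_subset (s := {I : Ideal (𝓞 K) | I ≠ ⊥})
    (f := fun I : Ideal (𝓞 K) ↦ (Ideal.absNorm I : ℂ) ^ (-s)) fun _ hI h ↦ ?_
  simp [h, hs0] at hI

theorem _root_.IsDedekindZeta.mul_LSeries {Z : ℂ → ℂ} (hZ : IsDedekindZeta K Z) {s : ℂ}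
    (hs : 1 < s.re) :
    Z s * LSeries (fun n ↦ ∑ I ∈ idealsOfNorm K n, (moebiusK K I : ℂ)) s = 1 := by
  rw [hZ.eq_LSeries hs, ← tsum_eq_LSeries (by simp) hs,
    ← tsum_eq_LSeries (fun I ↦ by simpa using abs_moebiusK_le I) hs]
  exact tsum_mul_tsum_moebiusK hs

theorem _root_.IsDedekindZeta.ne_zero {Z : ℂ → ℂ} (hZ : IsDedekindZeta K Z) {s : ℂ}
    (hs : 1 < s.re) :
    Z s ≠ 0 := left_ne_zero_of_mul_eq_one (hZ.mul_LSeries hs)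

theorem integrableOn_mul_cpow {f : ℝ → ℝ} (hf : Measurable f) {C r : ℝ}
    (hC : ∀ x, 1 ≤ x → |f x| ≤ C * x ^ r) {s : ℂ} (hs : r < s.re) :
    IntegrableOn (fun x : ℝ ↦ (f x : ℂ) * (x : ℂ) ^ (-s - 1)) (Set.Ioi 1) := by
  have h := (integrableOn_Ioi_rpow_of_lt (a := r - s.re - 1) (by linarith) one_pos).const_mul C
  refine h.mono' (by fun_prop) ?_
  refine (ae_restrict_mem measurableSet_Ioi).mono fun x (hx : 1 < x) ↦ ?_
  have hx0 : 0 < x := by linarith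
  rw [norm_mul, norm_cpow_eq_rpow_re_of_pos hx0, norm_real, Real.norm_eq_abs]
  calc _ ≤ C * x ^ r * x ^ (-s - 1).re := by gcongr; exact hC x hx.le
    _ = _ := by
      rw [mul_assoc, ← Real.rpow_add hx0]
      congr 2
      simp
      ring

/-- The Mellin transform of the summatory function of a bounded function on ideals. -/
theorem hasTransform_sum {g : Ideal (𝓞 K) → ℝ} (hg : ∀ I, |g I| ≤ 1) {s : ℂ} (hs : 1 < s.re) :
    HasTransform (fun t ↦ ∑ k ∈ Finset.Icc 1 ⌊t⌋₊, ∑ I ∈ idealsOfNorm K k, g I) s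
      (1 / s * LSeries (fun n ↦ ∑ I ∈ idealsOfNorm K n, (g I : ℂ)) s) := by
  have hs0 : s ≠ 0 := by rintro rfl; simp at hs; linarith
  obtain ⟨C, hC⟩ := exists_idealCount_le K
  constructor
  · refine integrableOn_mul_cpow ?_ (C := C) (r := 1) (fun x hx ↦ ?_) hs
    · exact (measurable_from_nat (f := fun n ↦ ∑ k ∈ Finset.Icc 1 n, ∑ I ∈ idealsOfNorm K k,
        g I)).comp Nat.measurable_floor
    · rw [Real.rpow_one]
      refine le_trans ?_ (hC x hx)
      refine (Finset.abs_sum_le_sum_abs _ _).trans (Finset.sum_le_sum fun k _ ↦ ?_)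
      refine (Finset.abs_sum_le_sum_abs _ _).trans ?_
      refine (Finset.sum_le_sum fun I _ ↦ hg I).trans ?_
      simp
  · rw [LSeries_eq_mul_integral' _ zero_le_one hs (isBigO_sum_norm fun I ↦ by simpa using hg I),
      one_div, inv_mul_cancel_left₀ hs0]
    refine integral_congr_ae (.of_forall fun x ↦ ?_)
    simp [sub_eq_add_neg, add_comm]

theorem _root_.IsDedekindZeta.hasTransform_mertensSum {Z : ℂ → ℂ} (hZ : IsDedekindZeta K Z) {s : ℂ}
    (hs : 1 < s.re) : HasTransform (mertensSum K) s (1 / (s * Z s)) := by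
  have h := hasTransform_sum (K := K) (g := fun I ↦ (moebiusK K I : ℝ)) abs_moebiusK_le hs
  have h2 := eq_one_div_of_mul_eq_one_right (hZ.mul_LSeries hs)
  simp only [ofReal_intCast] at h
  rw [h2, one_div_mul_one_div] at h
  exact h

theorem _root_.IsDedekindZeta.hasTransform_idealCount {Z : ℂ → ℂ} (hZ : IsDedekindZeta K Z) {s : ℂ}
    (hs : 1 < s.re) : HasTransform (idealCount K) s (1 / s * Z s) := by
  have h := hasTransform_sum (K := K) (g := fun _ ↦ 1) (by simp) hs
  rw [hZ.eq_LSeries hs]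
  simpa [HasTransform, idealCount] using h

theorem differentiableAt_transform {f : ℝ → ℝ} (hf : Measurable f) {C r : ℝ}
    (hC : ∀ x, 1 ≤ x → |f x| ≤ C * x ^ r) {s : ℂ} (hs : r < s.re) :
    DifferentiableAt ℂ (fun s : ℂ ↦ ∫ x in Set.Ioi (1 : ℝ), (f x : ℂ) * (x : ℂ) ^ (-s - 1)) s := by
  set F : ℝ → ℂ := (Set.Ioi 1).indicator fun x ↦ (f x : ℂ) with hF
  have hFm : Measurable F := by
    rw [hF]
    exact (by fun_prop : Measurable fun x ↦ (f x : ℂ)).indicator measurableSet_Ioi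
  have hb : ∀ x : ℝ, 0 < x → ‖F x‖ ≤ |C| * x ^ r := fun x hx ↦ by
    rw [hF, Set.indicator_apply]
    split_ifs with h
    · rw [norm_real, Real.norm_eq_abs]
      exact (hC x (le_of_lt h)).trans (by gcongr; exact le_abs_self C)
    · rw [norm_zero]; positivity
  have h1 : (fun s : ℂ ↦ ∫ x in Set.Ioi (1 : ℝ), (f x : ℂ) * (x : ℂ) ^ (-s - 1)) =
      fun s ↦ mellin F (-s) := by
    ext s
    rw [mellin, ← integral_indicator measurableSet_Ioi, ← integral_indicator measurableSet_Ioi]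
    refine integral_congr_ae (.of_forall fun x ↦ ?_)
    simp only [Set.indicator_apply, Set.mem_Ioi, hF, smul_eq_mul]
    split_ifs with h h' h'
    · rw [mul_comm]
    · exact absurd (by linarith) h'
    · simp
    · rfl
  rw [h1]
  refine DifferentiableAt.comp s (g := mellin F) (f := fun s ↦ -s) ?_ (by fun_prop)
  refine mellin_differentiableAt_of_isBigO_rpow (a := -r) (b := (-s).re - 1) ?_ ?_ ?_ ?_ ?_
  · have hcont : LocallyIntegrableOn (fun x : ℝ ↦ |C| * x ^ r) (Set.Ioi 0) := by
      refine ContinuousOn.locallyIntegrableOn ?_ measurableSet_Ioi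
      exact continuousOn_const.mul fun x hx ↦
        (Real.continuousAt_rpow_const _ _ (Or.inl (ne_of_gt hx))).continuousWithinAt
    rw [locallyIntegrableOn_iff isOpen_Ioi.isLocallyClosed] at hcont ⊢
    intro k hk hkc
    refine (hcont k hk hkc).mono' hFm.aestronglyMeasurable ?_
    exact (ae_restrict_mem hkc.measurableSet).mono fun x hx ↦ hb x (hk hx)
  · refine .of_bound |C| ?_
    filter_upwards [eventually_gt_atTop 0] with x hx
    rw [neg_neg, Real.norm_of_nonneg (Real.rpow_nonneg hx.le _)]
    exact hb x hx
  · simpa using hs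
  · have : F =ᶠ[𝓝[>] 0] fun _ ↦ 0 := by
      have := Ioo_mem_nhdsGT (zero_lt_one' ℝ)
      filter_upwards [this] with x hx
      rw [hF, Set.indicator_of_notMem]
      simpa using hx.2.le
    exact this.trans_isBigO (Asymptotics.isBigO_zero _ _)
  · linarith

/-- A power saving in the ideal counting function forces `ζ_K` to have a simple pole at `1`. -/
theorem _root_.IsDedekindZeta.exists_analyticAt_one {Z : ℂ → ℂ} (hZ : IsDedekindZeta K Z)
    {κ δ C : ℝ} (hκ : κ ≠ 0) (hδ : 0 < δ)
    (hC : ∀ t, 1 ≤ t → |idealCount K t - κ * t| ≤ C * t ^ (1 - δ)) :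
    ∃ g : ℂ → ℂ, AnalyticAt ℂ g 1 ∧ ∀ᶠ s in 𝓝[≠] (1 : ℂ), 1 / (s * Z s) = g s := by
  have hEm : Measurable fun t ↦ idealCount K t - κ * t :=
    (measurable_idealCount K).sub (by fun_prop)
  set G : ℂ → ℂ := fun s ↦ ∫ x in Set.Ioi (1 : ℝ),
    ((idealCount K x - κ * x : ℝ) : ℂ) * (x : ℂ) ^ (-s - 1) with hG
  set h : ℂ → ℂ := fun s ↦ s * (κ + (s - 1) * G s) with hh
  have hhd : ∀ s : ℂ, 1 - δ < s.re → DifferentiableAt ℂ h s := fun s hs ↦ by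
    have := differentiableAt_transform hEm hC hs
    fun_prop
  have heq1 : ∀ s : ℂ, 1 < s.re → Z s * (s - 1) = h s := fun s hs ↦ by
    have hs0 : s ≠ 0 := by rintro rfl; simp at hs; linarith
    have hs1 : s - 1 ≠ 0 := by intro h; rw [sub_eq_zero.1 h] at hs; simp at hs
    have h1 := hZ.hasTransform_idealCount hs
    have h2 := (hasTransform_rpow_mul_log_pow 1 0 (s := s) (by simpa using hs)).const_mul (-κ)
    have h3 := (h1.add h2).2
    have h4 : G s = 1 / s * Z s - κ * (1 / (s - 1)) := by
      rw [hG]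
      refine Eq.trans ?_ (h3.trans (by simp [sub_eq_add_neg]))
      refine integral_congr_ae (.of_forall fun x ↦ ?_)
      simp [sub_eq_add_neg]
    rw [hh]
    simp only [h4]
    field_simp
    ring
  have hid (U : Set ℂ) (hU : Convex ℝ U) (hUo : IsOpen U) (hU1 : (1 : ℂ) ∉ U)
      (hUδ : ∀ s ∈ U, 1 - δ < s.re) (z : ℂ) (hz : z ∈ U)
      (he : (fun s ↦ Z s * (s - 1)) =ᶠ[𝓝 z] h) : Set.EqOn (fun s ↦ Z s * (s - 1)) h U := by
    refine AnalyticOnNhd.eqOn_of_preconnected_of_eventuallyEq (𝕜 := ℂ) (z₀ := z) ?_ ?_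
      hU.isPreconnected hz he
    · refine DifferentiableOn.analyticOnNhd (fun s hs ↦ ?_) hUo
      have := hZ.1 s (fun h ↦ hU1 (h ▸ hs))
      exact (this.mul (by fun_prop)).differentiableWithinAt
    · exact DifferentiableOn.analyticOnNhd
        (fun s hs ↦ (hhd s (hUδ s hs)).differentiableWithinAt) hUo
  have hre (a : ℝ) : IsOpen {s : ℂ | a < s.re} := isOpen_lt continuous_const continuous_re
  have hup : Set.EqOn (fun s ↦ Z s * (s - 1)) h ({s | 1 - δ < s.re} ∩ {s | 0 < s.im}) := by
    refine hid _ ((convex_halfSpace_re_gt _).inter (convex_halfSpace_im_gt _))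
      ((hre _).inter (isOpen_lt continuous_const continuous_im)) (by simp) (fun s hs ↦ hs.1)
      (2 + I) ⟨by simp; linarith, by simp⟩ ?_
    filter_upwards [(hre 1).mem_nhds (by simp : (2 + I : ℂ) ∈ {s : ℂ | 1 < s.re})] with s hs
    exact heq1 s hs
  have hdown : Set.EqOn (fun s ↦ Z s * (s - 1)) h ({s | 1 - δ < s.re} ∩ {s | s.im < 0}) := by
    refine hid _ ((convex_halfSpace_re_gt _).inter (convex_halfSpace_im_lt _))
      ((hre _).inter (isOpen_lt continuous_im continuous_const)) (by simp) (fun s hs ↦ hs.1)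
      (2 - I) ⟨by simp; linarith, by simp⟩ ?_
    filter_upwards [(hre 1).mem_nhds (by simp : (2 - I : ℂ) ∈ {s : ℂ | 1 < s.re})] with s hs
    exact heq1 s hs
  have hleft : Set.EqOn (fun s ↦ Z s * (s - 1)) h ({s | 1 - δ < s.re} ∩ {s | s.re < 1}) := by
    have hm : ((1 - δ / 2 : ℝ) + I : ℂ) ∈ {s : ℂ | 1 - δ < s.re} ∩ {s | 0 < s.im} :=
      ⟨by simp only [Set.mem_ofPred_eq, add_re, ofReal_re, I_re]; linarith, by simp⟩
    refine hid _ ((convex_halfSpace_re_gt _).inter (convex_halfSpace_re_lt _))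
      ((hre _).inter (isOpen_lt continuous_re continuous_const)) (by simp) (fun s hs ↦ hs.1)
      ((1 - δ / 2 : ℝ) + I) ⟨hm.1, by
        simp only [Set.mem_ofPred_eq, add_re, ofReal_re, I_re]; linarith⟩ ?_
    filter_upwards [((hre _).inter (isOpen_lt continuous_const continuous_im)).mem_nhds hm]
      with s hs using hup hs
  have heq : ∀ s : ℂ, 1 - δ < s.re → s ≠ 1 → Z s * (s - 1) = h s := fun s hs hs1 ↦ by
    rcases lt_trichotomy s.re 1 with h1 | h1 | h1
    · exact hleft ⟨hs, h1⟩
    · rcases lt_trichotomy s.im 0 with h2 | h2 | h2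
      · exact hdown ⟨hs, h2⟩
      · exact absurd (Complex.ext h1 h2) hs1
      · exact hup ⟨hs, h2⟩
    · exact heq1 s h1
  have h1 : h 1 ≠ 0 := by simp [hh, hκ]
  have hha : AnalyticAt ℂ h 1 := by
    rw [Complex.analyticAt_iff_eventually_differentiableAt]
    filter_upwards [(hre (1 - δ)).mem_nhds (by simpa using hδ : (1 : ℂ) ∈ {s : ℂ | 1 - δ < s.re})]
      with s hs using hhd s hs
  refine ⟨fun s ↦ (s - 1) / (s * h s), ?_, ?_⟩
  · exact (analyticAt_id.sub analyticAt_const).div (analyticAt_id.mul hha) (by simpa using h1)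
  · filter_upwards [nhdsWithin_le_nhds ((hre (1 - δ)).mem_nhds
      (by simpa using hδ : (1 : ℂ) ∈ {s : ℂ | 1 - δ < s.re})), self_mem_nhdsWithin] with s hs hs1
    rw [← heq s hs hs1]
    have : s - 1 ≠ 0 := sub_ne_zero.2 hs1
    rw [mul_comm (Z s), mul_left_comm, div_mul_cancel_left₀ this, one_div]

section ConeCounting

open InfinitePlace mixedEmbedding fundamentalCone NumberField.Units
  NumberField.Units.dirichletUnitTheorem

variable (K) in
/-- The parameter box of the truncated fundamental cone, enlarged by `η` in the unit directions. -/
def coneBox (L η : ℝ) : Set (realSpace K) :=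
  Set.univ.pi fun w ↦ if w = w₀ then Set.Iic L else Set.Ico (-η) (1 + η)

variable (K) in
/-- The truncated fundamental cone, enlarged by `η` in the unit directions. -/
def thickCone (L η : ℝ) : Set (mixedSpace K) :=
  normAtAllPlaces ⁻¹' (expMapBasis '' coneBox K L η)

theorem measurableSet_coneBox (L η : ℝ) : MeasurableSet (coneBox K L η) := by
  refine MeasurableSet.univ_pi fun _ ↦ ?_
  split_ifs
  · exact measurableSet_Iic
  · exact measurableSet_Ico

theorem setLIntegral_coneBox_exp {n : ℕ} (hn : 0 < n) (L : ℝ) {η : ℝ} (hη : 0 ≤ 1 + 2 * η) :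
    ∫⁻ x in coneBox K L η, .ofReal (Real.exp (x w₀ * n)) =
      .ofReal (Real.exp (n * L) / n * (1 + 2 * η) ^ (rank K)) := by
  have hn : 0 < (n : ℝ) := Nat.cast_pos.mpr hn
  rw [volume_pi, coneBox, Measure.restrict_pi_pi, lintegral_eq_lmarginal_univ 0,
    lmarginal_erase' _ (by fun_prop) (Finset.mem_univ w₀), if_pos rfl]
  simp_rw [Function.update_self, lmarginal, lintegral_const, Measure.pi_univ, if_neg
    (Finset.ne_of_mem_erase (Subtype.prop _)), Measure.restrict_apply_univ, Real.volume_Ico,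
    mul_comm _ (n : ℝ)]
  rw [← ofReal_integral_eq_lintegral_ofReal (integrableOn_exp_mul_Iic hn _), integral_exp_mul_Iic
    hn, Finset.prod_const, ENNReal.ofReal_mul (by positivity), ENNReal.ofReal_pow hη]
  · congr 2
    · ring_nf
    · simp [rank]
  · filter_upwards with _ using Real.exp_nonneg _

variable (K) in
theorem exists_volume_thickCone : ∃ V : ℝ, 0 < V ∧ ∀ L η : ℝ, 0 ≤ 1 + 2 * η →
    volume (thickCone K L η) =
      .ofReal (V * (Real.exp (Module.finrank ℚ K * L) * (1 + 2 * η) ^ (rank K))) := by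
  refine ⟨2 ^ nrRealPlaces K * (2 * Real.pi) ^ nrComplexPlaces K *
    ((2⁻¹) ^ nrComplexPlaces K * regulator K), by have := regulator_pos K; positivity,
    fun L η hη ↦ ?_⟩
  have hn : (0 : ℝ) < Module.finrank ℚ K := Nat.cast_pos.mpr Module.finrank_pos
  have hR := regulator_pos K
  have hm : MeasurableSet (thickCone K L η) :=
    ((measurableSet_coneBox L η).image_of_continuousOn_injOn (continuous_expMapBasis K).continuousOn
      (injective_expMapBasis K).injOn).preimage (continuous_normAtAllPlaces K).measurable
  rw [thickCone] at hm ⊢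
  rw [volume_eq_two_pow_mul_two_pi_pow_mul_integral Set.preimage_image_preimage hm,
    normAtAllPlaces_image_preimage_expMapBasis,
    setLIntegral_expMapBasis_image (measurableSet_coneBox L η) (by fun_prop)]
  simp_rw [ENNReal.inv_mul_cancel_right
    (Finset.prod_ne_zero_iff.mpr fun _ _ ↦ ENNReal.ofReal_ne_zero_iff.mpr (expMapBasis_pos _ _))
    (ENNReal.prod_ne_top fun _ _ ↦ ENNReal.ofReal_ne_top)]
  rw [setLIntegral_coneBox_exp Module.finrank_pos L hη]
  have h2 : (2⁻¹ : ENNReal) = ENNReal.ofReal 2⁻¹ := by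
    rw [ENNReal.ofReal_inv_of_pos two_pos, ENNReal.ofReal_ofNat]
  have h3 : (2 : ENNReal) = ENNReal.ofReal 2 := by simp
  rw [h2, h3, ← ENNReal.ofReal_natCast, ← ENNReal.ofReal_pow (by positivity),
    ← ENNReal.ofReal_pow (by positivity), ← ENNReal.ofReal_pow (by positivity),
    ← ENNReal.ofReal_mul (by positivity), ← ENNReal.ofReal_mul (by positivity),
    ← ENNReal.ofReal_mul (by positivity), ← ENNReal.ofReal_mul (by positivity),
    ← ENNReal.ofReal_mul (by positivity)]
  congr 1
  field_simp

/-- The parameters of a point of the mixed space: its inverse image under `expMapBasis`. -/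
def coneParam (y : mixedSpace K) : realSpace K :=
  (completeBasis K).equivFun fun w ↦ w.mult * Real.log (normAtPlace w y)

theorem expMapBasis_coneParam {y : mixedSpace K} (hy : ∀ w, 0 < normAtPlace w y) :
    expMapBasis (coneParam y) = normAtAllPlaces y := by
  ext w
  rw [expMapBasis_apply, coneParam, LinearEquiv.symm_apply_apply, expMap_apply,
    inv_mul_cancel_left₀ mult_coe_ne_zero, Real.exp_log (hy w), normAtAllPlaces_apply]

theorem mem_thickCone {L η : ℝ} {y : mixedSpace K} :
    y ∈ thickCone K L η ↔ (∀ w, 0 < normAtPlace w y) ∧ coneParam y ∈ coneBox K L η := by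
  refine ⟨?_, fun ⟨h, h'⟩ ↦ ⟨_, h', expMapBasis_coneParam h⟩⟩
  rintro ⟨z, hz, hzy⟩
  have hy : ∀ w, 0 < normAtPlace w y := fun w ↦ by
    rw [← normAtAllPlaces_apply, ← hzy]; exact expMapBasis_pos _ _
  refine ⟨hy, ?_⟩
  rwa [injective_expMapBasis K ((expMapBasis_coneParam hy).trans hzy.symm)]

theorem mem_coneBox {L η : ℝ} {z : realSpace K} :
    z ∈ coneBox K L η ↔ z w₀ ≤ L ∧ ∀ w, w ≠ w₀ → z w ∈ Set.Ico (-η) (1 + η) := by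
  simp only [coneBox, Set.mem_univ_pi]
  refine ⟨fun h ↦ ⟨by simpa using h w₀, fun w hw ↦ by simpa [hw] using h w⟩, fun ⟨h, h'⟩ w ↦ ?_⟩
  split_ifs with hw
  · exact hw ▸ h
  · exact h' w hw

theorem mem_thickCone_zero {L : ℝ} {x : mixedSpace K} :
    x ∈ thickCone K L 0 ↔
      x ∈ fundamentalCone K ∧ mixedEmbedding.norm x ≤ Real.exp (Module.finrank ℚ K * L) := by
  rw [mem_thickCone]
  have key : (∀ w, 0 < normAtPlace w x) → (coneParam x ∈ coneBox K L 0 ↔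
      x ∈ fundamentalCone K ∧ mixedEmbedding.norm x ≤ Real.exp (Module.finrank ℚ K * L)) := by
    intro hx
    have hn : (0 : ℝ) < Module.finrank ℚ K := Nat.cast_pos.mpr Module.finrank_pos
    rw [← normAtAllPlaces_mem_fundamentalCone_iff, ← norm_normAtAllPlaces,
      ← expMapBasis_coneParam hx, fundamentalCone, Set.mem_sdiff, Set.mem_preimage,
      logMap_expMapBasis, Set.mem_ofPred_eq, norm_expMapBasis, ← Real.exp_nat_mul,
      Real.exp_le_exp, mul_le_mul_iff_right₀ hn, mem_coneBox]
    simp [Real.exp_ne_zero, and_comm]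
  exact ⟨fun ⟨h, h'⟩ ↦ (key h).1 h', fun h ↦
    ⟨normAtPlace_pos_of_mem h.1, (key (normAtPlace_pos_of_mem h.1)).2 h⟩⟩

theorem normAtPlace_le_norm (w : InfinitePlace K) (x : mixedSpace K) :
    normAtPlace w x ≤ ‖x‖ := by
  rw [norm_eq_sup'_normAtPlace]
  exact Finset.le_sup' (fun w ↦ normAtPlace w x) (Finset.mem_univ w)

variable (K) in
/-- Points whose unit parameters are bounded have comparable coordinates. -/
theorem exists_norm_le_mul_normAtPlace : ∃ B : ℝ, 0 < B ∧ ∀ y : mixedSpace K,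
    (∀ w, 0 < normAtPlace w y) → (∀ w, w ≠ w₀ → |coneParam y w| ≤ 2) →
      ∀ w, ‖y‖ ≤ B * normAtPlace w y := by
  set S : ℝ := ∑ v, ∑ i, 2 * |(completeBasis K) i v| with hS
  have hlog : ∀ y : mixedSpace K, (∀ w, 0 < normAtPlace w y) →
      (∀ w, w ≠ w₀ → |coneParam y w| ≤ 2) → ∀ v,
      |Real.log (normAtPlace v y) - coneParam y w₀| ≤ S := by
    intro y hy hy' v
    have h := congrFun ((completeBasis K).equivFun_symm_apply (coneParam y)) v
    rw [coneParam, LinearEquiv.symm_apply_apply, ← coneParam,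
      Fintype.sum_eq_add_sum_subtype_ne _ w₀, Pi.add_apply, Pi.smul_apply,
      completeBasis_apply_of_eq, Finset.sum_apply, smul_eq_mul] at h
    have hm : (1 : ℝ) ≤ v.mult := by exact_mod_cast v.mult_pos
    have h1 : v.mult * (Real.log (normAtPlace v y) - coneParam y w₀) =
        ∑ i : {w : InfinitePlace K // w ≠ w₀}, (coneParam y i • completeBasis K i) v := by
      linarith
    have h2 : |∑ i : {w : InfinitePlace K // w ≠ w₀}, (coneParam y i • completeBasis K i) v| ≤ S := by
      refine (Finset.abs_sum_le_sum_abs _ _).trans ?_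
      calc ∑ i : {w : InfinitePlace K // w ≠ w₀}, |(coneParam y i • completeBasis K i) v|
          ≤ ∑ i : {w : InfinitePlace K // w ≠ w₀}, 2 * |(completeBasis K) i v| := by
            refine Finset.sum_le_sum fun i _ ↦ ?_
            rw [Pi.smul_apply, smul_eq_mul, abs_mul]
            exact mul_le_mul_of_nonneg_right (hy' i i.2) (abs_nonneg _)
        _ ≤ ∑ i, 2 * |(completeBasis K) i v| := by
            rw [Fintype.sum_eq_add_sum_subtype_ne (fun i ↦ 2 * |(completeBasis K) i v|) w₀]
            linarith [abs_nonneg ((completeBasis K) w₀ v)]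
        _ ≤ S := Finset.single_le_sum (f := fun v ↦ ∑ i, 2 * |(completeBasis K) i v|)
            (fun v _ ↦ by positivity) (Finset.mem_univ v)
    rw [← h1, abs_mul, abs_of_pos (by linarith)] at h2
    nlinarith [abs_nonneg (Real.log (normAtPlace v y) - coneParam y w₀)]
  refine ⟨Real.exp (2 * S), Real.exp_pos _, fun y hy hy' w ↦ ?_⟩
  rw [norm_eq_sup'_normAtPlace]
  refine Finset.sup'_le _ _ fun v _ ↦ ?_
  rw [← Real.exp_log (hy v), ← Real.exp_log (hy w), ← Real.exp_add, Real.exp_le_exp]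
  have h1 := abs_le.1 (hlog y hy hy' v)
  have h2 := abs_le.1 (hlog y hy hy' w)
  linarith

theorem abs_log_sub_log_le {a b : ℝ} (ha : 0 < a) (h : |b - a| ≤ a / 2) :
    |Real.log b - Real.log a| ≤ 2 * |b - a| / a := by
  obtain ⟨h1, h2⟩ := abs_le.1 h
  have hb : 0 < b := by linarith
  have e : Real.log b - Real.log a = Real.log (b / a) := (Real.log_div hb.ne' ha.ne').symm
  rw [abs_le]
  constructor
  · have := Real.log_le_sub_one_of_pos (div_pos ha hb)
    rw [Real.log_div ha.ne' hb.ne'] at this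
    have h3 : a / b - 1 ≤ 2 * |b - a| / a := by
      rw [div_sub_one hb.ne', div_le_div_iff₀ hb ha]
      nlinarith [neg_abs_le (b - a), abs_nonneg (b - a)]
    linarith
  · rw [e]
    refine (Real.log_le_sub_one_of_pos (div_pos hb ha)).trans ?_
    rw [div_sub_one ha.ne']
    gcongr
    nlinarith [le_abs_self (b - a), abs_nonneg (b - a)]

variable (K) in
/-- Parameters vary slowly far from the origin. -/
theorem exists_abs_coneParam_add_sub_le (r : ℝ) : ∃ c : ℝ, 0 < c ∧
    ∀ R, c ≤ R → ∀ y p : mixedSpace K, (∀ w, 0 < normAtPlace w y) →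
      (∀ w, w ≠ w₀ → |coneParam y w| ≤ 2) → R ≤ ‖y‖ → ‖p‖ ≤ r →
      (∀ w, 0 < normAtPlace w (y + p)) ∧
        ∀ w, |coneParam (y + p) w - coneParam y w| ≤ c / R := by
  obtain ⟨B, hB, hBy⟩ := exists_norm_le_mul_normAtPlace K
  set A := ‖((completeBasis K).equivFunL : realSpace K →L[ℝ] realSpace K)‖
  have hA : 0 ≤ A := norm_nonneg _
  refine ⟨2 * B * (|r| + 1) + A * (4 * B * (|r| + 1)), by positivity,
    fun R hR y p hy hy' hyR hp ↦ ?_⟩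
  set r' := |r| + 1
  have hr' : 0 < r' := by positivity
  have hp' : ‖p‖ ≤ r' := hp.trans ((le_abs_self r).trans (by simp [r']))
  have hR2 : 2 * B * r' ≤ R := le_trans (le_add_of_nonneg_right (by positivity)) hR
  have hRpos : 0 < R := lt_of_lt_of_le (by positivity) hR2
  have hlow : ∀ w, R / B ≤ normAtPlace w y := fun w ↦ by
    rw [div_le_iff₀ hB, mul_comm]; exact hyR.trans (hBy y hy hy' w)
  have hdiff : ∀ w, |normAtPlace w (y + p) - normAtPlace w y| ≤ r' := fun w ↦ by
    have h1 := normAtPlace_add_le w y p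
    have h2 := normAtPlace_add_le w (y + p) (-p)
    rw [add_neg_cancel_right, normAtPlace_neg] at h2
    have h3 := normAtPlace_le_norm w p
    exact abs_le.2 ⟨by linarith, by linarith⟩
  have hhalf : ∀ w, r' ≤ normAtPlace w y / 2 := fun w ↦ by
    have h1 : 2 * r' ≤ R / B := by rw [le_div_iff₀ hB]; linarith
    linarith [hlow w]
  refine ⟨fun w ↦ by linarith [hhalf w, (abs_le.1 (hdiff w)).1, hy w], fun w ↦ ?_⟩
  have hlog : ∀ w, |Real.log (normAtPlace w (y + p)) - Real.log (normAtPlace w y)| ≤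
      2 * r' * B / R := fun w ↦ by
    refine (abs_log_sub_log_le (hy w) ((hdiff w).trans (hhalf w))).trans ?_
    rw [div_le_div_iff₀ (hy w) hRpos]
    have h1 : R ≤ B * normAtPlace w y := by
      have := hlow w
      rw [div_le_iff₀ hB] at this
      linarith
    calc 2 * |normAtPlace w (y + p) - normAtPlace w y| * R ≤ 2 * r' * (B * normAtPlace w y) := by
          gcongr; exact hdiff w
      _ = _ := by ring
  set f : realSpace K := fun w ↦ w.mult * Real.log (normAtPlace w (y + p)) -
    w.mult * Real.log (normAtPlace w y) with hf
  have hfn : ‖f‖ ≤ 4 * B * r' / R := by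
    refine (pi_norm_le_iff_of_nonneg (by positivity)).2 fun w ↦ ?_
    rw [hf, Real.norm_eq_abs]
    simp only
    rw [← mul_sub, abs_mul, Nat.abs_cast]
    have hm : (w.mult : ℝ) ≤ 2 := by
      rw [mult]; split_ifs <;> norm_num
    calc (w.mult : ℝ) * _ ≤ 2 * (2 * r' * B / R) := by gcongr; exact hlog w
      _ = _ := by ring
  have hcf : coneParam (y + p) - coneParam y =
      ((completeBasis K).equivFunL : realSpace K →L[ℝ] realSpace K) f := by
    rw [coneParam, coneParam, ← map_sub]
    rfl
  calc |coneParam (y + p) w - coneParam y w| = ‖(coneParam (y + p) - coneParam y) w‖ := rfl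
    _ ≤ ‖coneParam (y + p) - coneParam y‖ := norm_le_pi_norm _ w
    _ ≤ A * (4 * B * r' / R) := by
        rw [hcf]
        exact (ContinuousLinearMap.le_opNorm _ _).trans (by gcongr)
    _ = A * (4 * B * r') / R := by ring
    _ ≤ _ := by gcongr; exact le_add_of_nonneg_left (by positivity)

theorem abs_coneParam_le_two {L η : ℝ} (hη : η ≤ 1) {y : mixedSpace K}
    (hy : y ∈ thickCone K L η) (w : InfinitePlace K) (hw : w ≠ w₀) : |coneParam y w| ≤ 2 := by
  have := (mem_coneBox.1 (mem_thickCone.1 hy).2).2 w hw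
  exact abs_le.2 ⟨by linarith [this.1], by linarith [this.2]⟩

theorem isBounded_thickCone_zero (L : ℝ) : Bornology.IsBounded (thickCone K L 0) := by
  obtain ⟨B, hB, hBy⟩ := exists_norm_le_mul_normAtPlace K
  refine isBounded_iff_forall_norm_le.2 ⟨B * Real.exp L, fun y hy ↦ ?_⟩
  have hpos := (mem_thickCone.1 hy).1
  have h1 : ‖y‖ ^ Module.finrank ℚ K ≤ (B * Real.exp L) ^ Module.finrank ℚ K := by
    calc ‖y‖ ^ Module.finrank ℚ K = ∏ w : InfinitePlace K, ‖y‖ ^ w.mult := by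
          rw [Finset.prod_pow_eq_pow_sum, sum_mult_eq]
      _ ≤ ∏ w : InfinitePlace K, (B * normAtPlace w y) ^ w.mult := by
          gcongr with w
          exact hBy y hpos (abs_coneParam_le_two zero_le_one hy) w
      _ = B ^ Module.finrank ℚ K * mixedEmbedding.norm y := by
          simp_rw [mul_pow, Finset.prod_mul_distrib, Finset.prod_pow_eq_pow_sum, sum_mult_eq,
            mixedEmbedding.norm_apply]
      _ ≤ B ^ Module.finrank ℚ K * Real.exp (Module.finrank ℚ K * L) := by
          gcongr
          exact (mem_thickCone_zero.1 hy).2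
      _ = _ := by rw [mul_pow, Real.exp_nat_mul]
  exact le_of_pow_le_pow_left₀ Module.finrank_pos.ne' (by positivity) h1

theorem mem_thickCone_of_abs_sub_le {L η δ : ℝ} {y z : mixedSpace K}
    (hy : y ∈ thickCone K L η) (hz : ∀ w, 0 < normAtPlace w z)
    (h : ∀ w, |coneParam z w - coneParam y w| ≤ δ) : z ∈ thickCone K (L + δ) (η + δ) := by
  have hy' := mem_coneBox.1 (mem_thickCone.1 hy).2
  refine mem_thickCone.2 ⟨hz, mem_coneBox.2 ⟨?_, fun w hw ↦ ⟨?_, ?_⟩⟩⟩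
  · linarith [(abs_le.1 (h w₀)).2, hy'.1]
  · linarith [(abs_le.1 (h w)).1, (hy'.2 w hw).1]
  · linarith [(abs_le.1 (h w)).2, (hy'.2 w hw).2]

theorem exists_abs_exp_mul_pow_sub_one_le (n m : ℕ) : ∃ D ε : ℝ, 0 < D ∧ 0 < ε ∧ ∀ u : ℝ, |u| ≤ ε →
    |Real.exp (n * u) * (1 + 2 * u) ^ m - 1| ≤ D * |u| := by
  have hd : DifferentiableAt ℝ (fun u : ℝ ↦ Real.exp (n * u) * (1 + 2 * u) ^ m) 0 := by fun_prop
  obtain ⟨D, hD, hD'⟩ := hd.hasDerivAt.isBigO_sub.exists_pos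
  obtain ⟨ε, hε, h⟩ := Metric.eventually_nhds_iff.1 hD'.bound
  refine ⟨D, ε / 2, hD, by positivity, fun u hu ↦ ?_⟩
  simpa using h (y := u) (by rw [Real.dist_eq, sub_zero]; linarith)

theorem exists_abs_ncard_lattice_inter_thickCone_sub_le {ι : Type*} [Finite ι]
    (b : Module.Basis ι ℝ (mixedSpace K)) : ∃ κ C L₀ : ℝ, 0 < κ ∧ ∀ L, L₀ ≤ L →
      |(Nat.card ↥({x | x ∈ thickCone K L 0} ∩
          (Submodule.span ℤ (Set.range b) : Set (mixedSpace K))) : ℝ)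
        - κ * Real.exp (Module.finrank ℚ K * L)| ≤ C * Real.exp (Module.finrank ℚ K * L - L / 2) := by
  set n := Module.finrank ℚ K with hn
  have hn1 : (1 : ℝ) ≤ n := by exact_mod_cast Module.finrank_pos
  obtain ⟨V, hV, hvol⟩ := exists_volume_thickCone K
  obtain ⟨r, hr⟩ := isBounded_iff_forall_norm_le.1 (ZSpan.fundamentalDomain_isBounded b)
  obtain ⟨c, hc, hpert⟩ := exists_abs_coneParam_add_sub_le K r
  obtain ⟨D, ε, hD, hε, hg⟩ := exists_abs_exp_mul_pow_sub_one_le n (rank K)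
  set F := ZSpan.fundamentalDomain b
  have hF0 : volume F ≠ 0 := ZSpan.measure_fundamentalDomain_ne_zero b
  have hFt : volume F ≠ ⊤ := (ZSpan.fundamentalDomain_isBounded b).measure_lt_top.ne
  set f := (volume F).toReal
  have hf : 0 < f := ENNReal.toReal_pos hF0 hFt
  have hfF : volume F = .ofReal f := (ENNReal.ofReal_toReal hFt).symm
  set v := (volume (Metric.ball (0 : mixedSpace K) 1)).toReal
  have hv : 0 ≤ v := ENNReal.toReal_nonneg
  have hball : ∀ ρ : ℝ, 0 ≤ ρ → volume (Metric.ball (0 : mixedSpace K) ρ) = .ofReal (ρ ^ n * v) := by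
    intro ρ hρ
    rw [Measure.addHaar_ball _ _ hρ, mixedEmbedding.finrank, ENNReal.ofReal_mul (by positivity),
      ENNReal.ofReal_toReal measure_ball_lt_top.ne]
  refine ⟨V / f, (V * D * c + 2 ^ n * v) / f,
    max 0 (2 * Real.log (max (max c (|r| + 1)) (c / (min ε (1 / 2))))), by positivity,
    fun L hL ↦ ?_⟩
  set R := Real.exp (L / 2) with hR
  have hRpos : 0 < R := Real.exp_pos _
  have hL0 : 0 ≤ L := (le_max_left _ _).trans hL
  have hRbig : max (max c (|r| + 1)) (c / (min ε (1 / 2))) ≤ R := by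
    have h1 := (le_max_right _ _).trans hL
    have h2 : (0 : ℝ) < max (max c (|r| + 1)) (c / (min ε (1 / 2))) :=
      lt_of_lt_of_le (lt_of_lt_of_le hc (le_max_left _ _)) (le_max_left _ _)
    rw [hR, ← Real.log_le_iff_le_exp h2]
    linarith
  have hRc : c ≤ R := ((le_max_left _ _).trans (le_max_left _ _)).trans hRbig
  have hRr : |r| + 1 ≤ R := ((le_max_right _ _).trans (le_max_left _ _)).trans hRbig
  set η := c / R with hη
  have hηpos : 0 < η := by positivity
  have hηε : η ≤ min ε (1 / 2) := by
    have h1 := (le_max_right _ _).trans hRbig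
    rw [div_le_iff₀ (by positivity)] at h1
    rw [hη, div_le_iff₀ hRpos, mul_comm]
    exact h1
  have hη2 : η ≤ 1 / 2 := hηε.trans (min_le_right _ _)
  have hηe : η ≤ ε := hηε.trans (min_le_left _ _)
  have hfin : ({x | x ∈ thickCone K L 0} ∩
      (Submodule.span ℤ (Set.range b) : Set (mixedSpace K))).Finite :=
    ZSpan.setFinite_inter b (isBounded_thickCone_zero L)
  set A := hfin.toFinset with hA
  have hAmem : ∀ x, x ∈ A ↔ x ∈ thickCone K L 0 ∧ x ∈ Submodule.span ℤ (Set.range b) :=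
    fun x ↦ by rw [hA, Set.Finite.mem_toFinset]; rfl
  rw [Nat.card_coe_set_eq, Set.ncard_eq_toFinset_card _ hfin, ← hA]
  set X := Real.exp (n * L) with hX
  have hXpos : 0 < X := Real.exp_pos _
  have hXR : X / R = Real.exp (n * L - L / 2) := by rw [Real.exp_sub]
  have hRn : R ^ n ≤ X / R := by
    rw [hXR, hR, ← Real.exp_nat_mul, Real.exp_le_exp]
    nlinarith
  have hvolη : ∀ u : ℝ, 0 ≤ 1 + 2 * u → volume (thickCone K (L + u) u) =
      .ofReal (V * X * (Real.exp (n * u) * (1 + 2 * u) ^ rank K)) := by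
    intro u hu
    rw [hvol _ _ hu, mul_add, Real.exp_add]
    congr 1
    ring
  have hup : A.card * f ≤ V * X * (1 + D * η) + (2 * R) ^ n * v := by
    have h1 := card_mul_measure_fundamentalDomain_le b volume (A := A)
      (T := thickCone K (L + η) η ∪ Metric.ball 0 (2 * R))
      (fun x hx ↦ ((hAmem x).1 hx).2) (fun x hx p hp ↦ by
        have hxc := ((hAmem x).1 hx).1
        rcases lt_or_ge ‖x‖ R with hlt | hge
        · right
          rw [mem_ball_zero_iff]
          have := norm_add_le x p
          linarith [hr p hp, le_abs_self r]
        · left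
          obtain ⟨h2, h3⟩ := hpert R hRc x p (mem_thickCone.1 hxc).1
            (abs_coneParam_le_two zero_le_one hxc) hge (hr p hp)
          simpa using mem_thickCone_of_abs_sub_le hxc h2 h3)
    have h2 := h1.trans (measure_union_le _ _)
    rw [hvolη η (by linarith), hball _ (by positivity),
      ← ENNReal.ofReal_add (by positivity) (by positivity), hfF, ← ENNReal.ofReal_natCast,
      ← ENNReal.ofReal_mul (Nat.cast_nonneg _), ENNReal.ofReal_le_ofReal_iff (by positivity)] at h2
    have h3 := (abs_le.1 (hg η (by rwa [abs_of_pos hηpos]))).2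
    rw [abs_of_pos hηpos] at h3
    refine h2.trans ?_
    gcongr
    linarith
  have hlo : V * X * (1 - D * η) - (2 * R) ^ n * v ≤ A.card * f := by
    have h1 := measure_le_card_mul_measure_fundamentalDomain b volume (A := A)
      (U := thickCone K (L + -η) (-η) \ Metric.ball 0 (2 * R)) (fun y hy p hp hyp ↦ by
        refine (hAmem _).2 ⟨?_, hyp⟩
        have hyR : R ≤ ‖y‖ := by
          have := hy.2
          rw [mem_ball_zero_iff, not_lt] at this
          linarith
        obtain ⟨h2, h3⟩ := hpert R hRc y (-p) (mem_thickCone.1 hy.1).1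
          (abs_coneParam_le_two (by linarith) hy.1) hyR (by rw [norm_neg]; exact hr p hp)
        have h4 := mem_thickCone_of_abs_sub_le hy.1 h2 h3
        rwa [← hη, neg_add_cancel_right, neg_add_cancel, ← sub_eq_add_neg] at h4)
    have h2 := le_measure_sdiff.trans h1
    have h0 : 0 ≤ 1 + 2 * -η := by linarith
    rw [hvolη (-η) h0, hball _ (by positivity),
      ← ENNReal.ofReal_sub _ (by positivity), hfF, ← ENNReal.ofReal_natCast,
      ← ENNReal.ofReal_mul (Nat.cast_nonneg _),
      ENNReal.ofReal_le_ofReal_iff (mul_nonneg (Nat.cast_nonneg _) hf.le)] at h2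
    have h3 := (abs_le.1 (hg (-η) (by rwa [abs_neg, abs_of_pos hηpos]))).1
    rw [abs_neg, abs_of_pos hηpos] at h3
    refine le_trans ?_ h2
    gcongr
    linarith
  have hηX : X * η = c * (X / R) := by rw [hη]; ring
  have hRv : (2 * R) ^ n * v ≤ 2 ^ n * v * (X / R) := by
    rw [mul_pow]
    calc 2 ^ n * R ^ n * v = 2 ^ n * v * R ^ n := by ring
      _ ≤ _ := by gcongr
  rw [← hXR, div_mul_eq_mul_div, div_mul_eq_mul_div]
  rw [abs_le]
  constructor
  · rw [neg_le_sub_iff_le_add, ← sub_le_iff_le_add, ← sub_div, div_le_iff₀ hf]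
    have : V * X * (1 - D * η) = V * X - V * D * c * (X / R) := by
      linear_combination (-V * D) * hηX
    linarith
  · rw [sub_le_iff_le_add, ← add_div, le_div_iff₀ hf]
    have : V * X * (1 + D * η) = V * X + V * D * c * (X / R) := by
      linear_combination (V * D) * hηX
    linarith

end ConeCounting

section ConeCounting

open _root_.Ideal InfinitePlace mixedEmbedding fundamentalCone NumberField.Units
open scoped nonZeroDivisors

theorem card_absNorm_le_and_mk_eq {C : ClassGroup (𝓞 K)} {J : (Ideal (𝓞 K))⁰}
    (hJ : ClassGroup.mk0 J = C⁻¹) (s : ℝ) :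
    Nat.card {I : (Ideal (𝓞 K))⁰ // absNorm (I : Ideal (𝓞 K)) ≤ s ∧ ClassGroup.mk0 I = C}
      = Nat.card {I : (Ideal (𝓞 K))⁰ // (J : Ideal (𝓞 K)) ∣ I ∧
        Submodule.IsPrincipal (I : Ideal (𝓞 K)) ∧
        absNorm (I : Ideal (𝓞 K)) ≤ s * absNorm (J : Ideal (𝓞 K))} := by
  simp_rw [← nonZeroDivisors_dvd_iff_dvd_coe]
  refine Nat.card_congr ?_
  refine ((Equiv.dvd J).subtypeEquiv fun I ↦ ?_).trans
    (Equiv.subtypeSubtypeEquivSubtypeInter (fun I : (Ideal (𝓞 K))⁰ ↦ J ∣ I) _)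
  rw [← ClassGroup.mk0_eq_one_iff (SetLike.coe_mem _)]
  simp_rw [Equiv.dvd_apply, Submonoid.coe_mul, ← Submonoid.mul_def, _root_.map_mul, hJ,
    inv_mul_eq_one, Nat.cast_mul, mul_comm s, eq_comm, and_comm, and_congr_left_iff]
  exact fun _ ↦
    (mul_le_mul_iff_of_pos_left (Nat.cast_pos.mpr (absNorm_pos_of_nonZeroDivisors J))).symm

theorem card_idealSet_norm_le (J : (Ideal (𝓞 K))⁰) (L : ℝ) :
    Nat.card {a : idealSet K J // mixedEmbedding.norm (a : mixedSpace K) ≤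
        Real.exp (Module.finrank ℚ K * L)} =
      Nat.card ↥({x | x ∈ thickCone K L 0} ∩ (Submodule.span ℤ (Set.range
        (fractionalIdealLatticeBasis K (FractionalIdeal.mk0 K J))) : Set (mixedSpace K))) := by
  rw [span_idealLatticeBasis]
  refine Nat.card_congr ((Equiv.subtypeSubtypeEquivSubtypeInter (fun x ↦ x ∈ idealSet K J)
    (mixedEmbedding.norm · ≤ _)).trans (Equiv.subtypeEquivRight fun x ↦ ?_))
  rw [idealSet, Set.mem_inter_iff, Set.mem_inter_iff, Set.mem_ofPred_eq, mem_thickCone_zero]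
  tauto

theorem exists_card_absNorm_le_and_mk_eq_isBigO (C : ClassGroup (𝓞 K)) : ∃ κ : ℝ, 0 < κ ∧
    (fun s : ℝ ↦ (Nat.card {I : (Ideal (𝓞 K))⁰ // absNorm (I : Ideal (𝓞 K)) ≤ s ∧
      ClassGroup.mk0 I = C} : ℝ) - κ * s) =O[atTop]
        fun s : ℝ ↦ s ^ (1 - (2 * Module.finrank ℚ K : ℝ)⁻¹) := by
  obtain ⟨J, hJ⟩ := ClassGroup.mk0_surjective C⁻¹
  obtain ⟨κ, D, L₀, hκ, h⟩ := exists_abs_ncard_lattice_inter_thickCone_sub_le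
    (fractionalIdealLatticeBasis K (FractionalIdeal.mk0 K J))
  set n := Module.finrank ℚ K
  have hn : (0 : ℝ) < n := Nat.cast_pos.mpr Module.finrank_pos
  set N : ℝ := (absNorm (J : Ideal (𝓞 K)) : ℝ)
  have hN : 0 < N := Nat.cast_pos.mpr (absNorm_pos_of_nonZeroDivisors J)
  have hT : (0 : ℝ) < torsionOrder K := Nat.cast_pos.mpr
      (Nat.pos_of_ne_zero (torsionOrder_ne_zero K))
  refine ⟨κ * N / torsionOrder K, by positivity, .of_bound
    (D * N ^ (1 - (2 * n : ℝ)⁻¹) / torsionOrder K) ?_⟩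
  filter_upwards [eventually_gt_atTop 0, eventually_ge_atTop (Real.exp (n * L₀) / N)] with s hs hs'
  set L := Real.log (s * N) / n with hL
  have hnL : Real.exp (n * L) = s * N := by
    rw [hL, mul_div_cancel₀ _ hn.ne', Real.exp_log (by positivity)]
  have hnL' : Real.exp (n * L - L / 2) = s ^ (1 - (2 * n : ℝ)⁻¹) * N ^ (1 - (2 * n : ℝ)⁻¹) := by
    rw [← Real.mul_rpow hs.le hN.le, Real.rpow_def_of_pos (by positivity), hL]
    congr 1
    field_simp
  have hLL : L₀ ≤ L := by
    rw [div_le_iff₀ hN, ← hnL, Real.exp_le_exp] at hs'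
    exact le_of_mul_le_mul_left hs' hn
  have key := h L hLL
  rw [← card_idealSet_norm_le, hnL, hnL', ← card_isPrincipal_dvd_norm_le,
    ← card_absNorm_le_and_mk_eq hJ, Nat.cast_mul] at key
  rw [Real.norm_eq_abs, Real.norm_of_nonneg (by positivity), div_mul_eq_mul_div,
    div_mul_eq_mul_div, le_div_iff₀ hT]
  have abs_mul_torsionOrder (x : ℝ) : |x| * (torsionOrder K : ℝ) = |x * torsionOrder K| := by
    rw [abs_mul, abs_of_pos hT]
  rw [abs_mul_torsionOrder, sub_mul, div_mul_cancel₀ _ hT.ne']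
  refine le_of_eq_of_le ?_ (key.trans_eq (by ring))
  congr 2
  ring

end ConeCounting

open scoped nonZeroDivisors in
theorem idealCount_eq_sum_card (t : ℝ) (ht : 0 ≤ t) : idealCount K t =
    ∑ C : ClassGroup (𝓞 K), (Nat.card {I : (Ideal (𝓞 K))⁰ //
      Ideal.absNorm (I : Ideal (𝓞 K)) ≤ t ∧ ClassGroup.mk0 I = C} : ℝ) := by
  rw [idealCount_eq_card]
  have : Fintype {I : (Ideal (𝓞 K))⁰ // Ideal.absNorm (I : Ideal (𝓞 K)) ≤ t} := by
    simp_rw [← Nat.le_floor_iff ht]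
    exact @Fintype.ofFinite _ (Ideal.finite_setOfPred_absNorm_le₀ ⌊t⌋₊)
  let e := fun C : ClassGroup (𝓞 K) ↦ Equiv.subtypeSubtypeEquivSubtypeInter
    (fun I : (Ideal (𝓞 K))⁰ ↦ Ideal.absNorm I.1 ≤ t) (fun I ↦ ClassGroup.mk0 I = C)
  simp_rw [← Nat.card_congr (e _), Nat.card_eq_fintype_card, Fintype.subtype_card]
  rw [Fintype.card, Finset.card_eq_sum_card_fiberwise (f := fun I ↦ ClassGroup.mk0 I.1)
    (t := Finset.univ) (fun _ _ ↦ Finset.mem_univ _), Nat.cast_sum]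

variable (K) in
theorem exists_abs_idealCount_sub_le : ∃ κ δ C : ℝ, κ ≠ 0 ∧ 0 < δ ∧
    ∀ t, 1 ≤ t → |idealCount K t - κ * t| ≤ C * t ^ (1 - δ) := by
  have hn : (1 : ℝ) ≤ Module.finrank ℚ K := by exact_mod_cast Module.finrank_pos
  set δ := (2 * Module.finrank ℚ K : ℝ)⁻¹ with hδ
  have hδ0 : 0 < δ := by positivity
  have hδ1 : δ ≤ 1 := inv_le_one_of_one_le₀ (by linarith)
  choose κ hκ hO using fun C : ClassGroup (𝓞 K) ↦ exists_card_absNorm_le_and_mk_eq_isBigO C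
  have hκs : 0 < ∑ C, κ C := Finset.sum_pos (fun C _ ↦ hκ C) Finset.univ_nonempty
  obtain ⟨B, hB, hbound⟩ := (Asymptotics.IsBigO.sum fun C (_ : C ∈ Finset.univ) ↦ hO C).exists_pos
  obtain ⟨T, hT⟩ := eventually_atTop.1 hbound.bound
  obtain ⟨D, hD⟩ := exists_idealCount_le K
  refine ⟨∑ C, κ C, δ, B + (|D| + ∑ C, κ C) * |T|, hκs.ne', hδ0, fun t ht ↦ ?_⟩
  have hpow : 1 ≤ t ^ (1 - δ) := Real.one_le_rpow ht (by linarith)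
  rcases le_or_gt T t with h | h
  · have := hT t h
    simp only [Finset.sum_apply] at this
    rw [Finset.sum_sub_distrib, ← idealCount_eq_sum_card t (by linarith), ← Finset.sum_mul,
      Real.norm_eq_abs, Real.norm_of_nonneg (by positivity)] at this
    refine this.trans ?_
    gcongr
    exact le_add_of_nonneg_right (by positivity)
  · have h0 : 0 ≤ idealCount K t := by rw [idealCount_eq_card]; positivity
    have h1 := hD t ht
    have h2 : |idealCount K t - (∑ C, κ C) * t| ≤ (|D| + ∑ C, κ C) * |T| := by
      calc |idealCount K t - (∑ C, κ C) * t| ≤ |idealCount K t| + |(∑ C, κ C) * t| := abs_sub _ _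
        _ ≤ |D| * t + (∑ C, κ C) * t := by
            rw [abs_of_nonneg h0, abs_of_nonneg (by positivity : 0 ≤ (∑ C, κ C) * t)]
            gcongr
            exact h1.trans (by gcongr; exact le_abs_self D)
        _ = (|D| + ∑ C, κ C) * t := by ring
        _ ≤ _ := by gcongr; exact h.le.trans (le_abs_self T)
    refine h2.trans ?_
    refine le_trans ?_ (le_mul_of_one_le_right (by positivity) hpow)
    linarith

/-- The one-sided form of the oscillation theorem, with the sign `ε = ±1`. -/
theorem le_const_of_eventually_mertensK_le
    {Z : ℂ → ℂ} (hZ : IsDedekindZeta K Z) {Θ : ℝ}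
    {ρ : ℂ} (hρ1 : 0 < ρ.re) (hρ2 : ρ.re < 1) (hρim : ρ.im ≠ 0)
    (hρre : ρ.re = Θ) {m : ℕ} (hm : 1 ≤ m)
    (hmult : ∀ j : ℕ, j < m → iteratedDeriv j Z ρ = 0) (hmult' : iteratedDeriv m Z ρ ≠ 0)
    {A : Finset ℝ} (hA : ∀ x : ℝ, x ∈ A ↔ (0 < x ∧ x < 1 ∧ Z (x : ℂ) = 0))
    {mα : ℝ → ℕ} {c : ℝ → ℕ → ℂ}
    (hc : ∀ x : ℝ, 0 < x → x < 1 →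
      ∃ g : ℂ → ℂ, AnalyticAt ℂ g (x : ℂ) ∧
        ∀ᶠ s in 𝓝[≠] (x : ℂ),
          1 / (s * Z s) =
            (∑ a ∈ A, ∑ k ∈ Finset.Icc 1 (mα a), c a k / (s - (a : ℂ)) ^ k) + g s)
    {ε : ℝ} (hε : |ε| = 1) {c' : ℝ}
    (hle : ∀ᶠ x : ℝ in atTop, ε * ((mertensK K x -
              ∑ a ∈ A, ∑ k ∈ Finset.Icc 1 (mα a),
                (c a k).re * x ^ a * Real.log x ^ (k - 1) / (Nat.factorial (k - 1))) /
            (x ^ Θ * Real.log x ^ (m - 1))) ≤ c') :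
    m / ‖ρ * iteratedDeriv m Z ρ‖ ≤ c' := by
  obtain ⟨κ, δ, C, hκ, hδ, hC⟩ := exists_abs_idealCount_sub_le K
  obtain ⟨g₁, hg₁, hg₁'⟩ := hZ.exists_analyticAt_one hκ hδ hC
  obtain ⟨C', hC'⟩ := exists_idealCount_le K
  obtain ⟨X, hX⟩ := hle.exists_forall_of_atTop
  have hA1 : ∀ x ∈ A, x < 1 := fun x hx ↦ ((hA x).1 hx).2.1
  have hpp : ∀ x : ℝ, 1 ≤ x → AnalyticAt ℂ
      (fun s : ℂ ↦ ∑ a ∈ A, ∑ k ∈ Finset.Icc 1 (mα a), c a k / (s - (a : ℂ)) ^ k) x := by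
    intro x hx
    refine Finset.analyticAt_fun_sum _ fun a ha ↦ Finset.analyticAt_fun_sum _ fun k _ ↦ ?_
    refine analyticAt_const.div ((analyticAt_id.sub analyticAt_const).pow k) (pow_ne_zero _ ?_)
    change (x : ℂ) - a ≠ 0
    rw [← ofReal_sub, ofReal_ne_zero]
    linarith [hA1 a ha]
  refine le_const_of_ae_le (mα := mα) (c := c) (x₀ := max X 2)
      hZ.1 hρ1 hρ2 hρim hρre hm hmult hmult' hA1 ?_
    (measurable_mertensSum K) (fun x hx ↦ (abs_mertensSum_le x).trans (hC' x hx))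
    (fun s hs ↦ hZ.ne_zero hs) (fun s hs ↦ hZ.hasTransform_mertensSum hs) hε (by simp) ?_
  · intro x hx0
    rcases lt_trichotomy x 1 with hx | rfl | hx
    · exact hc x hx0 hx
    · refine ⟨_, hg₁.sub (by simpa using hpp 1 le_rfl), ?_⟩
      rw [ofReal_one]
      filter_upwards [hg₁'] with s hs
      rw [hs, Pi.sub_apply, add_sub_cancel]
    · have hZx : AnalyticAt ℂ (fun s ↦ 1 / (s * Z s)) x := by
        refine analyticAt_const.div (analyticAt_id.mul ?_) (mul_ne_zero ?_ (hZ.ne_zero (by simpa)))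
        · rw [Complex.analyticAt_iff_eventually_differentiableAt]
          have hx1 : (x : ℂ) ≠ 1 := by exact_mod_cast hx.ne'
          filter_upwards [isOpen_ne.mem_nhds hx1] with s hs using hZ.1 s hs
        · simpa using hx0.ne'
      refine ⟨_, hZx.sub (hpp x hx.le), .of_forall fun s ↦ ?_⟩
      rw [Pi.sub_apply, add_sub_cancel]
  · filter_upwards [ae_mertensK_eq_mertensSum K] with x hx hxX
    have h := hX x ((le_max_left _ _).trans hxX.le)
    have hx2 : 2 < x := (le_max_right _ _).trans_lt hxX
    have hpos : 0 < x ^ Θ * Real.log x ^ (m - 1) :=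
      mul_pos (Real.rpow_pos_of_pos (by linarith) _) (pow_pos (Real.log_pos (by linarith)) _)
    rw [hx, ← mul_div_assoc, div_le_iff₀ hpos] at h
    exact h

end NumberField.Mertens

/-- **Proposition 2.9.** Suppose `ζ_K` has a non-real nontrivial zero `ρ = Θ'' + iγ` of
multiplicity `m ≥ 1` whose real part equals `Θ''`, the supremum of the real parts of the
non-real nontrivial zeros. Let `M̃_K` be built from the principal parts of `1/(s ζ_K(s))`
at the real zeros `α ∈ (0,1)`. Then
`liminf (M_K(x) - M̃_K(x))/(x^{Θ''} (log x)^{m-1}) ≤ -m/|ρ ζ_K^{(m)}(ρ)|` and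
`limsup (M_K(x) - M̃_K(x))/(x^{Θ''} (log x)^{m-1}) ≥ m/|ρ ζ_K^{(m)}(ρ)|`. -/
theorem omega_pm_zero_on_rightmost_line
    (K : Type) [Field K] [NumberField K]
    (Z : ℂ → ℂ) (hZ : IsDedekindZeta K Z)
    (Θ'' : ℝ)
    (hΘ'' : IsLUB {x : ℝ | ∃ ρ : ℂ, Z ρ = 0 ∧ 0 < ρ.re ∧ ρ.re < 1 ∧ ρ.im ≠ 0 ∧ ρ.re = x}
      Θ'')
    (ρ : ℂ) (hρ0 : Z ρ = 0) (hρ1 : 0 < ρ.re) (hρ2 : ρ.re < 1) (hρim : ρ.im ≠ 0)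
    (hρre : ρ.re = Θ'')
    (m : ℕ) (hm : 1 ≤ m)
    (hmult : (∀ j : ℕ, j < m → iteratedDeriv j Z ρ = 0) ∧ iteratedDeriv m Z ρ ≠ 0)
    -- the real zeros of `ζ_K` in `(0,1)`, their multiplicities, and the principal-part
    -- coefficients `c α k` of `1/(s ζ_K(s))` at each real zero `α`
    (A : Finset ℝ) (hA : ∀ x : ℝ, x ∈ A ↔ (0 < x ∧ x < 1 ∧ Z (x : ℂ) = 0))
    (mα : ℝ → ℕ) (c : ℝ → ℕ → ℂ)
    (hc : ∀ x : ℝ, 0 < x → x < 1 →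
      ∃ g : ℂ → ℂ, AnalyticAt ℂ g (x : ℂ) ∧
        ∀ᶠ s in 𝓝[≠] (x : ℂ),
          1 / (s * Z s) =
            (∑ a ∈ A, ∑ k ∈ Finset.Icc 1 (mα a), c a k / (s - (a : ℂ)) ^ k) + g s) :
    Filter.liminf
        (fun x : ℝ =>
          (((mertensK K x -
              ∑ a ∈ A, ∑ k ∈ Finset.Icc 1 (mα a),
                (c a k).re * x ^ a * Real.log x ^ (k - 1) / (Nat.factorial (k - 1))) /
            (x ^ Θ'' * Real.log x ^ (m - 1)) : ℝ) : EReal))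
        Filter.atTop
      ≤ ((-(m / ‖ρ * iteratedDeriv m Z ρ‖) : ℝ) : EReal) ∧
    ((m / ‖ρ * iteratedDeriv m Z ρ‖ : ℝ) : EReal)
      ≤ Filter.limsup
          (fun x : ℝ =>
            (((mertensK K x -
                ∑ a ∈ A, ∑ k ∈ Finset.Icc 1 (mα a),
                  (c a k).re * x ^ a * Real.log x ^ (k - 1) / (Nat.factorial (k - 1))) /
              (x ^ Θ'' * Real.log x ^ (m - 1)) : ℝ) : EReal))
          Filter.atTop := by
  constructor
  · by_contra! h
    obtain ⟨c', hc1, hc2⟩ := EReal.lt_iff_exists_real_btwn.1 h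
    refine absurd (NumberField.Mertens.le_const_of_eventually_mertensK_le hZ hρ1 hρ2 hρim hρre hm
      hmult.1 hmult.2 hA hc (ε := -1) (c' := -c') (by simp) ?_) ?_
    · filter_upwards [eventually_lt_of_lt_liminf hc2] with x hx
      rw [neg_one_mul, neg_le_neg_iff]
      exact (EReal.coe_lt_coe_iff.1 hx).le
    · rw [not_le]
      linarith [EReal.coe_lt_coe_iff.1 hc1]
  · by_contra! h
    obtain ⟨c', hc1, hc2⟩ := EReal.lt_iff_exists_real_btwn.1 h
    refine absurd (NumberField.Mertens.le_const_of_eventually_mertensK_le hZ hρ1 hρ2 hρim hρre hm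
      hmult.1 hmult.2 hA hc (ε := 1) (c' := c') (by simp) ?_) ?_
    · filter_upwards [eventually_lt_of_limsup_lt hc1] with x hx
      rw [one_mul]
      exact (EReal.coe_lt_coe_iff.1 hx).le
    · exact not_le.2 (EReal.coe_lt_coe_iff.1 hc2)
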